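/- arXiv:2203.00855 — 2 statements merged into one kernel-verified Lean document; each statement's English description precedes it below -/
import Mathlib

section
/- Upper bound on the closest reachable point on the −x-axis for large excess: Let σ be a turn sequence with l L's and r R's and l − r ≥ 3. If l − r ≡ 2 (mod 4) and the last turn σₙ = R, then there exists a chain realizing σ whose endpoint is (−a, 0) for some integer a with 1 ≤ a ≤ ⌊(l − r + 2)/4⌋ + 1. Otherwise (i.e., if l − r ≢ 2 (mod 4), or σₙ = L), there exists a chain realizing σ whose endpoint is (−a, 0) for some integer a with 1 ≤ a ≤ ⌊(l − r + 2)/4⌋. -/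
/-- A turn: left (`L`) or right (`R`). -/
inductive Turn : Type
  | L : Turn
  | R : Turn
  deriving DecidableEq

/-- Rotation of a direction vector by 90° counterclockwise. -/
def rotCCW (d : ℤ × ℤ) : ℤ × ℤ := (-d.2, d.1)

/-- Rotation of a direction vector by 90° clockwise. -/
def rotCW (d : ℤ × ℤ) : ℤ × ℤ := (d.2, -d.1)

/-- Unit direction of the axis-parallel segment from `u` to `v`. -/
def unitDir (u v : ℤ × ℤ) : ℤ × ℤ := ((v.1 - u.1).sign, (v.2 - u.2).sign)

/-- The set of integer points on the axis-parallel closed segment from `u` to `v`. -/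
def segSet (u v : ℤ × ℤ) : Set (ℤ × ℤ) :=
  {q | min u.1 v.1 ≤ q.1 ∧ q.1 ≤ max u.1 v.1 ∧ min u.2 v.2 ≤ q.2 ∧ q.2 ≤ max u.2 v.2}

/-- A simple rectilinear chain realizing the turn sequence `σ = σ₁⋯σₙ` (as a list,
`σ.get ⟨i, _⟩` is the `(i+1)`-st turn `σ_{i+1}`).  It consists of the points
`pts 0, …, pts (n+1)` with `pts 0 = (0,0)`; consecutive points span nondegenerate
axis-parallel segments, the first segment heads east, the chain turns left (CCW) or
right (CW) at each bend as prescribed by `σ`, and the chain is simple. -/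
structure Chain (σ : List Turn) where
  pts : ℕ → ℤ × ℤ
  start_eq : pts 0 = (0, 0)
  first_seg : ∃ t : ℤ, 0 < t ∧ pts 1 = (t, 0)
  axis_parallel : ∀ i ≤ σ.length,
    ((pts (i + 1)).1 = (pts i).1 ∧ (pts (i + 1)).2 ≠ (pts i).2) ∨
    ((pts (i + 1)).2 = (pts i).2 ∧ (pts (i + 1)).1 ≠ (pts i).1)
  turns : ∀ i, ∀ h : i < σ.length,
    unitDir (pts (i + 1)) (pts (i + 2)) =
      (if σ.get ⟨i, h⟩ = Turn.L then rotCCW else rotCW) (unitDir (pts i) (pts (i + 1)))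
  simple_adj : ∀ i, i + 1 ≤ σ.length →
    segSet (pts i) (pts (i + 1)) ∩ segSet (pts (i + 1)) (pts (i + 2)) = {pts (i + 1)}
  simple_nonadj : ∀ i j, i + 1 < j → j ≤ σ.length →
    segSet (pts i) (pts (i + 1)) ∩ segSet (pts j) (pts (j + 1)) = ∅

/-- `A(σ)`: the set of points reachable by the turn sequence `σ`. -/
def ReachSet (σ : List Turn) : Set (ℤ × ℤ) :=
  {q | ∃ C : Chain σ, C.pts (σ.length + 1) = q}

/-- The halfplane `V⁺(p)` (requires `p.1 ≠ 0` to be meaningful). -/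
def Vplus (p : ℤ × ℤ) : Set (ℤ × ℤ) :=
  {q | ∃ i j : ℤ, 0 ≤ i ∧ q = (p.1 + p.1.sign * i, j)}

/-- The halfplane `H⁺(p)` (requires `p.2 ≠ 0` to be meaningful). -/
def Hplus (p : ℤ × ℤ) : Set (ℤ × ℤ) :=
  {q | ∃ i j : ℤ, 0 ≤ j ∧ q = (i, p.2 + p.2.sign * j)}

/-- The quadrant `Q⁺(p)`. -/
def Qplus (p : ℤ × ℤ) : Set (ℤ × ℤ) := Vplus p ∩ Hplus p

/-- A staircase: consecutive turns always differ. -/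
def IsStaircase (σ : List Turn) : Prop := σ.Chain' (· ≠ ·)

/-- The prefix number `δᵢ`: number of `L`s minus number of `R`s among the first `i` turns. -/
def delta (σ : List Turn) (i : ℕ) : ℤ :=
  ((σ.take i).count Turn.L : ℤ) - ((σ.take i).count Turn.R : ℤ)

/-- The excess number `l - r` of a turn sequence. -/
def excess (σ : List Turn) : ℤ := (σ.count Turn.L : ℤ) - (σ.count Turn.R : ℤ)

/-- `σ` has a hook (two equal consecutive turns, at 1-based positions `k+1, k+2`)
whose prefix number is `≡ d (mod 4)`: `d = 0, 1, 2, 3` for right, up, left, down hooks. -/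
def HasHook (σ : List Turn) (d : ℤ) : Prop :=
  ∃ k, ∃ h : k + 1 < σ.length,
    σ.get ⟨k, by omega⟩ = σ.get ⟨k + 1, h⟩ ∧ delta σ (k + 1) % 4 = d

/-- `σ` has some hook, i.e. two equal consecutive turns. -/
def HasAnyHook (σ : List Turn) : Prop :=
  ∃ k, ∃ h : k + 1 < σ.length, σ.get ⟨k, by omega⟩ = σ.get ⟨k + 1, h⟩

/-- A set `S ⊆ ℤ²` is connected: any two points of `S` are joined by a path inside `S`
whose consecutive points are at `L¹`-distance `1`. -/
def GridConnected (S : Set (ℤ × ℤ)) : Prop :=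
  ∀ p ∈ S, ∀ q ∈ S, ∃ (n : ℕ) (f : ℕ → ℤ × ℤ),
    f 0 = p ∧ f n = q ∧ (∀ i ≤ n, f i ∈ S) ∧
    ∀ i < n, |(f (i + 1)).1 - (f i).1| + |(f (i + 1)).2 - (f i).2| = 1

/-- `q` lies on the boundary of the smallest axis-parallel bounding box of the chain `C`
(for `q` a point of the chain: it attains an extreme coordinate). -/
def OnBBoxBoundary (σ : List Turn) (C : Chain σ) (q : ℤ × ℤ) : Prop :=
  (∀ i ≤ σ.length + 1, q.1 ≤ (C.pts i).1) ∨ (∀ i ≤ σ.length + 1, (C.pts i).1 ≤ q.1) ∨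
  (∀ i ≤ σ.length + 1, q.2 ≤ (C.pts i).2) ∨ (∀ i ≤ σ.length + 1, (C.pts i).2 ≤ q.2)

/-- The last segment of the chain `C` is entirely contained in one side of the smallest
axis-parallel bounding box of `C`. -/
def LastSegOnSide (σ : List Turn) (C : Chain σ) : Prop :=
  ((C.pts σ.length).1 = (C.pts (σ.length + 1)).1 ∧
     ∀ i ≤ σ.length + 1, (C.pts σ.length).1 ≤ (C.pts i).1) ∨
  ((C.pts σ.length).1 = (C.pts (σ.length + 1)).1 ∧
     ∀ i ≤ σ.length + 1, (C.pts i).1 ≤ (C.pts σ.length).1) ∨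
  ((C.pts σ.length).2 = (C.pts (σ.length + 1)).2 ∧
     ∀ i ≤ σ.length + 1, (C.pts σ.length).2 ≤ (C.pts i).2) ∨
  ((C.pts σ.length).2 = (C.pts (σ.length + 1)).2 ∧
     ∀ i ≤ σ.length + 1, (C.pts i).2 ≤ (C.pts σ.length).2)

/-- The turn `σₘ` (1-based indexing). -/
def turnAt (σ : List Turn) (m : ℕ) : Turn := σ.getD (m - 1) Turn.L

/-- The suffix `σ_k ⋯ σ_n` contains no hook and all its prefix numbers `δᵢ`,
`k - 1 ≤ i ≤ n`, are `≡ 1` or `2 (mod 4)` (the combinatorial description of a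
NW-staircase containing the endpoint). -/
def GoodSuffix (σ : List Turn) (k : ℕ) : Prop :=
  1 ≤ k ∧ k ≤ σ.length ∧
  (∀ m : ℕ, k ≤ m → m < σ.length → turnAt σ m ≠ turnAt σ (m + 1)) ∧
  (∀ i : ℕ, k - 1 ≤ i → i ≤ σ.length → delta σ i % 4 = 1 ∨ delta σ i % 4 = 2)

open Classical in
/-- `₋ₓm₊ᵧᵖ(σ)`: taking the longest good suffix (i.e. the least `k` with
`GoodSuffix σ k`), the number of indices `i` with `k - 1 ≤ i ≤ n` and
`δᵢ ≡ 1 (mod 4)`; `0` if no good suffix exists. -/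
noncomputable def mNWp (σ : List Turn) : ℕ :=
  if ∃ k, GoodSuffix σ k then
    Nat.card {i : ℕ // sInf {k | GoodSuffix σ k} - 1 ≤ i ∧ i ≤ σ.length ∧
      delta σ i % 4 = 1}
  else 0

/-- The number of vertical segments of the chain `C` meeting the closed horizontal
segment from the origin to `(a, 0)`. -/
def verticalCrossCount (σ : List Turn) (C : Chain σ) (a : ℤ) : ℕ :=
  ((Finset.range (σ.length + 1)).filter fun i =>
    (C.pts i).1 = (C.pts (i + 1)).1 ∧
    0 ≤ (C.pts i).1 ∧ (C.pts i).1 ≤ a ∧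
    min (C.pts i).2 (C.pts (i + 1)).2 ≤ 0 ∧ 0 ≤ max (C.pts i).2 (C.pts (i + 1)).2).card

/-- The unit direction of the `(i+1)`-st segment of the chain `C`. -/
def dirOf (σ : List Turn) (C : Chain σ) (i : ℕ) : ℤ × ℤ := unitDir (C.pts i) (C.pts (i + 1))

/-- `z₁mz₂ᵒ(C)`: the number of `z₂`-segments in the maximal `(z₁,z₂)`-staircase subchain
of `C` containing the origin (the longest prefix of segments directed `z₁` or `z₂`);
`0` if no such subchain exists. -/
noncomputable def stairCountO (σ : List Turn) (C : Chain σ) (z₁ z₂ : ℤ × ℤ) : ℕ :=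
  Nat.card {i : ℕ // i ≤ σ.length ∧ dirOf σ C i = z₂ ∧
    ∀ j ≤ i, dirOf σ C j = z₁ ∨ dirOf σ C j = z₂}

/-- `z₁mz₂ᵖ(C)`: the number of `z₂`-segments in the maximal `(z₁,z₂)`-staircase subchain
of `C` containing the endpoint (the longest suffix of segments directed `z₁` or `z₂`);
`0` if no such subchain exists. -/
noncomputable def stairCountP (σ : List Turn) (C : Chain σ) (z₁ z₂ : ℤ × ℤ) : ℕ :=
  Nat.card {i : ℕ // i ≤ σ.length ∧ dirOf σ C i = z₂ ∧
    ∀ j, i ≤ j → j ≤ σ.length → dirOf σ C j = z₁ ∨ dirOf σ C j = z₂}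

/-- The coordinates of a rectilinear chain, read alternately: the `i`-th segment lies on the line
with coordinate `c (i + 1)` and runs from `c i` to `c (i + 2)`; even segments are horizontal.
The `i`-th and the `j`-th segment are disjoint. -/
def SegDisjoint (c : ℕ → ℤ) (i j : ℕ) : Prop :=
  (i % 2 = j % 2 → c (i + 1) = c (j + 1) →
    max (c i) (c (i + 2)) < min (c j) (c (j + 2)) ∨ max (c j) (c (j + 2)) < min (c i) (c (i + 2))) ∧
  (i % 2 ≠ j % 2 →
    c (j + 1) < min (c i) (c (i + 2)) ∨ max (c i) (c (i + 2)) < c (j + 1) ∨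
    c (i + 1) < min (c j) (c (j + 2)) ∨ max (c j) (c (j + 2)) < c (i + 1))

/-- The parity class of a turn. -/
def Turn.toNat : Turn → ℕ
  | Turn.L => 0
  | Turn.R => 1

/-- The segment following the turn `t` after the `i`-th segment points in the right direction. -/
def TurnOK (c : ℕ → ℤ) (i : ℕ) (t : Turn) : Prop :=
  (c i < c (i + 2) ↔ c (i + 1) < c (i + 3)) ↔ (t.toNat + i) % 2 = 0

/-- The alternating coordinates `c` describe a simple chain with turn sequence `σ`. -/
structure IsRealization (c : ℕ → ℤ) (σ : List Turn) : Prop where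
  ne : ∀ i ≤ σ.length, c i ≠ c (i + 2)
  turn : ∀ i t, σ[i]? = some t → TurnOK c i t
  disj : ∀ i j, i + 1 < j → j ≤ σ.length → SegDisjoint c i j

/-- The points of the chain with alternating coordinates `c`. -/
def alternatingPts (c : ℕ → ℤ) (i : ℕ) : ℤ × ℤ :=
  if i % 2 = 0 then (c i, c (i + 1)) else (c (i + 1), c i)

theorem IsRealization.exists_chain {c : ℕ → ℤ} {σ : List Turn} (h : IsRealization c σ)
    (h0 : c 0 = 0) (h1 : c 1 = 0) (h2 : 0 < c 2) : ∃ C : Chain σ, C.pts = alternatingPts c := by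
  refine ⟨{ pts := alternatingPts c, start_eq := ?_, first_seg := ?_, axis_parallel := ?_,
            turns := ?_, simple_adj := ?_, simple_nonadj := ?_ }, rfl⟩
  · simp [alternatingPts, h0, h1]
  · exact ⟨c 2, h2, by simp [alternatingPts, h1]⟩
  · intro i hi
    have := h.ne i hi
    rcases Nat.mod_two_eq_zero_or_one i with hp | hp
    · have hp' : (i + 1) % 2 = 1 := by omega
      simp [alternatingPts, hp, hp', this.symm]
    · have hp' : (i + 1) % 2 = 0 := by omega
      simp [alternatingPts, hp, hp', this.symm]
  · intro i hi
    have ha := h.ne i hi.le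
    have hb := h.ne (i + 1) hi
    have ht := h.turn i σ[i] (by simp [hi])
    rw [List.get_eq_getElem]
    generalize σ[i] = t at ht ⊢
    unfold TurnOK at ht
    simp only [add_assoc, Nat.reduceAdd] at hb
    have key : ∀ x y : ℤ, x ≠ y → (x < y ∧ (y - x).sign = 1 ∧ (x - y).sign = -1) ∨
        (y < x ∧ (y - x).sign = -1 ∧ (x - y).sign = 1) := by
      intro x y hxy
      rcases lt_or_gt_of_ne hxy with hlt | hlt
      · exact Or.inl ⟨hlt, Int.sign_eq_one_of_pos (by omega), Int.sign_eq_neg_one_of_neg (by omega)⟩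
      · exact Or.inr ⟨hlt, Int.sign_eq_neg_one_of_neg (by omega), Int.sign_eq_one_of_pos (by omega)⟩
    have ka := key _ _ ha
    have kb := key _ _ hb
    have hs : (1 + i) % 2 = 1 - i % 2 := by omega
    rcases Nat.mod_two_eq_zero_or_one i with hp | hp
    · have hp' : (i + 1) % 2 = 1 := by omega
      have hp'' : (i + 2) % 2 = 0 := by omega
      cases t <;> rcases ka with ⟨u1, u2, u3⟩ | ⟨u1, u2, u3⟩ <;>
        rcases kb with ⟨v1, v2, v3⟩ | ⟨v1, v2, v3⟩ <;>
        simp [alternatingPts, hp, hp', hp'', unitDir, rotCCW, rotCW, u1, u2, v1, v2, hs,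
          Turn.toNat, not_lt_of_gt] at ht ⊢
    · have hp' : (i + 1) % 2 = 0 := by omega
      have hp'' : (i + 2) % 2 = 1 := by omega
      cases t <;> rcases ka with ⟨u1, u2, u3⟩ | ⟨u1, u2, u3⟩ <;>
        rcases kb with ⟨v1, v2, v3⟩ | ⟨v1, v2, v3⟩ <;>
        simp [alternatingPts, hp, hp', hp'', unitDir, rotCCW, rotCW, u1, u2, v1, v2, hs,
          Turn.toNat, not_lt_of_gt] at ht ⊢
  · intro i hi
    ext ⟨x, y⟩
    rcases Nat.mod_two_eq_zero_or_one i with hp | hp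
    · have hp' : (i + 1) % 2 = 1 := by omega
      have hp'' : (i + 2) % 2 = 0 := by omega
      simp only [alternatingPts, segSet, hp, hp', hp'', if_true, one_ne_zero, if_false,
        Set.mem_inter_iff, Set.mem_ofPred_eq, Set.mem_singleton_iff, Prod.mk.injEq, add_assoc,
        Nat.reduceAdd]
      omega
    · have hp' : (i + 1) % 2 = 0 := by omega
      have hp'' : (i + 2) % 2 = 1 := by omega
      simp only [alternatingPts, segSet, hp, hp', hp'', if_true, one_ne_zero, if_false,
        Set.mem_inter_iff, Set.mem_ofPred_eq, Set.mem_singleton_iff, Prod.mk.injEq, add_assoc,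
        Nat.reduceAdd]
      omega
  · intro i j hij hj
    obtain ⟨hs, hd⟩ := h.disj i j hij hj
    rw [Set.eq_empty_iff_forall_notMem]
    rintro ⟨x, y⟩
    rcases Nat.mod_two_eq_zero_or_one i with hp | hp <;>
    rcases Nat.mod_two_eq_zero_or_one j with hq | hq
    all_goals
      have hp' : (i + 1) % 2 = 1 - i % 2 := by omega
      have hq' : (j + 1) % 2 = 1 - j % 2 := by omega
      simp only [alternatingPts, segSet, hp, hp', hq, hq', if_true, one_ne_zero, if_false,
        Nat.sub_self, Nat.sub_zero,
        Set.mem_inter_iff, Set.mem_ofPred_eq, add_assoc, Nat.reduceAdd] at hs hd ⊢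
      simp only [not_true, false_imp_iff, true_imp_iff, ne_eq, one_ne_zero, zero_ne_one,
        not_false_iff] at hs hd
      omega

/-- Only the relative order of the coordinates in each direction matters. -/
theorem IsRealization.of_lt_iff_lt {c d : ℕ → ℤ} {σ : List Turn} (h : IsRealization c σ)
    (hcd : ∀ i j, i % 2 = j % 2 → (d i < d j ↔ c i < c j)) : IsRealization d σ where
  ne i hi := by
    have := h.ne i hi
    have h1 := hcd i (i + 2) (by omega)
    have h2 := hcd (i + 2) i (by omega)
    omega
  turn i t ht := by
    have := h.turn i t ht
    unfold TurnOK at this ⊢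
    rwa [hcd i (i + 2) (by omega), hcd (i + 1) (i + 3) (by omega)]
  disj i j hij hj := by
    obtain ⟨hs, hd⟩ := h.disj i j hij hj
    refine ⟨fun hp he => ?_, fun hp => ?_⟩
    · have e1 := hcd (i + 1) (j + 1) (by omega)
      have e2 := hcd (j + 1) (i + 1) (by omega)
      have := hs hp (by omega)
      simp only [max_lt_iff, lt_min_iff] at this ⊢
      rwa [hcd i j (by omega), hcd (i + 2) j (by omega), hcd i (j + 2) (by omega),
        hcd (i + 2) (j + 2) (by omega), hcd j i (by omega), hcd (j + 2) i (by omega),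
        hcd j (i + 2) (by omega), hcd (j + 2) (i + 2) (by omega)]
    · have := hd hp
      simp only [max_lt_iff, lt_min_iff] at this ⊢
      rwa [hcd (j + 1) i (by omega), hcd (j + 1) (i + 2) (by omega), hcd i (j + 1) (by omega),
        hcd (i + 2) (j + 1) (by omega), hcd (i + 1) j (by omega), hcd (i + 1) (j + 2) (by omega),
        hcd j (i + 1) (by omega), hcd (j + 2) (i + 1) (by omega)]

theorem IsRealization.concat {c : ℕ → ℤ} {σ : List Turn} {n : ℕ} (h : IsRealization c σ)
    (hn : σ.length = n) {t : Turn} (hne : c (n + 1) ≠ c (n + 3)) (ht : TurnOK c n t)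
    (hd : ∀ i < n, SegDisjoint c i (n + 1)) : IsRealization c (σ ++ [t]) where
  ne i hi := by
    simp only [List.length_append, List.length_singleton] at hi
    rcases Nat.lt_or_ge σ.length i with h' | h'
    · obtain rfl : i = n + 1 := by omega
      exact hne
    · exact h.ne i h'
  turn i s hs := by
    rcases Nat.lt_or_ge i σ.length with h' | h'
    · exact h.turn i s (by rwa [List.getElem?_append_left h'] at hs)
    · rw [List.getElem?_append_right h', List.getElem?_singleton] at hs
      split_ifs at hs with h0
      obtain rfl : i = n := by omega
      cases hs
      exact ht
  disj i j hij hj := by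
    simp only [List.length_append, List.length_singleton] at hj
    rcases Nat.lt_or_ge σ.length j with h' | h'
    · obtain rfl : j = n + 1 := by omega
      exact hd i (by omega)
    · exact h.disj i j hij h'

theorem IsRealization.of_concat {c : ℕ → ℤ} {σ : List Turn} {t : Turn}
    (h : IsRealization c (σ ++ [t])) : IsRealization c σ where
  ne i hi := h.ne i (by simp; omega)
  turn i s hs := h.turn i s (by
    rw [List.getElem?_append_left (List.getElem?_eq_some_iff.1 hs).1]; exact hs)
  disj i j hij hj := h.disj i j hij (by simp; omega)

theorem excess_concat_L (σ : List Turn) : excess (σ ++ [Turn.L]) = excess σ + 1 := by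
  simp [excess, List.count_append]; ring

theorem excess_concat_R (σ : List Turn) : excess (σ ++ [Turn.R]) = excess σ - 1 := by
  simp [excess, List.count_append]; ring

theorem excess_emod_two (σ : List Turn) : excess σ % 2 = (σ.length : ℤ) % 2 := by
  induction σ using List.reverseRecOn with
  | nil => simp [excess]
  | append_singleton σ t ih =>
    cases t
    · rw [excess_concat_L]; push_cast [List.length_append]; simp; omega
    · rw [excess_concat_R]; push_cast [List.length_append]; simp; omega

/-- The direction of the last segment is determined by the excess. -/
theorem IsRealization.last_lt_iff {c : ℕ → ℤ} {σ : List Turn} (h : IsRealization c σ)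
    (h0 : c 0 < c 2) : c σ.length < c (σ.length + 2) ↔ (excess σ % 4 = 0 ∨ excess σ % 4 = 1) := by
  induction σ using List.reverseRecOn with
  | nil => simpa [excess] using h0
  | append_singleton σ t ih =>
    have ih' := ih h.of_concat
    have ht := h.turn σ.length t (by simp)
    have hp := excess_emod_two σ
    unfold TurnOK at ht
    simp only [List.length_append, List.length_singleton, add_assoc, Nat.reduceAdd]
    cases t
    · rw [excess_concat_L]
      simp only [Turn.toNat] at ht
      omega
    · rw [excess_concat_R]
      simp only [Turn.toNat] at ht
      omega

/-- A short segment can always be attached at the end. -/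
theorem IsRealization.attach {c : ℕ → ℤ} {σ : List Turn} (h : IsRealization c σ) {n : ℕ}
    (hn : σ.length = n) {t : Turn} (ht : TurnOK c n t)
    (hadj : c (n + 3) = c (n + 1) + 1 ∨ c (n + 3) = c (n + 1) - 1)
    (hfresh : ∀ j ≤ n + 2, j % 2 = (n + 1) % 2 → c j ≠ c (n + 3)) :
    IsRealization c (σ ++ [t]) := by
  refine h.concat hn (by omega) ht fun i hi => ?_
  have hne := h.ne n hn.ge
  rcases Nat.lt_or_ge (i + 1) n with hi' | hi'
  · obtain ⟨hs, hd⟩ := h.disj i n hi' hn.ge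
    refine ⟨fun hp he => ?_, fun hp => ?_⟩
    · have f1 := hfresh i (by omega) (by omega)
      have f2 := hfresh (i + 2) (by omega) (by omega)
      have := hd (by omega)
      simp only [add_assoc, Nat.reduceAdd] at he ⊢
      omega
    · have f1 := hfresh (i + 1) (by omega) (by omega)
      have := hs (by omega)
      simp only [add_assoc, Nat.reduceAdd] at this ⊢
      omega
  · obtain rfl : n = i + 1 := by omega
    refine ⟨fun hp he => ?_, fun hp => by omega⟩
    simp only [add_assoc, Nat.reduceAdd] at he hne
    omega

theorem SegDisjoint.symm {c : ℕ → ℤ} {i j : ℕ} (h : SegDisjoint c i j) : SegDisjoint c j i := by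
  obtain ⟨hs, hd⟩ := h
  exact ⟨fun hp he => (hs hp.symm he.symm).symm, fun hp => by have := hd hp.symm; omega⟩

section jog

variable {u v w z m r p q s : ℤ}

theorem par_shrink (hm : min u w < m ∧ m < max u w)
    (h : q = v → max p s < min u w ∨ max u w < min p s) :
    q = v → max p s < min u m ∨ max u m < min p s := by
  omega

theorem perp_shrink (hm : min u w < m ∧ m < max u w)
    (h : v < min p s ∨ max p s < v ∨ q < min u w ∨ max u w < q) :
    v < min p s ∨ max p s < v ∨ q < min u m ∨ max u m < q := by
  omega

theorem perp_step (hm : min u w < m ∧ m < max u w) (hr : r = v + 1 ∨ r = v - 1)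
    (hq : q ≠ r) (h : q = v → max p s < min u w ∨ max u w < min p s) :
    m < min p s ∨ max p s < m ∨ q < min v r ∨ max v r < q := by
  omega

theorem perp_shift (hm : min u w < m ∧ m < max u w) (hr : r = v + 1 ∨ r = v - 1)
    (hp : p ≠ r) (hs : s ≠ r) (h : v < min p s ∨ max p s < v ∨ q < min u w ∨ max u w < q) :
    r < min p s ∨ max p s < r ∨ q < min m w ∨ max m w < q := by
  omega

theorem par_extend (hr : r = v + 1 ∨ r = v - 1) (hp : p ≠ r) (hs : s ≠ r)
    (h : q = w → max p s < min v z ∨ max v z < min p s) :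
    q = w → max p s < min r z ∨ max r z < min p s := by
  omega

theorem perp_extend (hr : r = v + 1 ∨ r = v - 1) (hq : q ≠ r)
    (h : w < min p s ∨ max p s < w ∨ q < min v z ∨ max v z < q) :
    w < min p s ∨ max p s < w ∨ q < min r z ∨ max r z < q := by
  omega

end jog

/-- Break the `i`-th segment at `m` and move its second half to the line with coordinate `r`. -/
def insertJog (c : ℕ → ℤ) (i : ℕ) (m r : ℤ) (j : ℕ) : ℤ :=
  if j ≤ i + 1 then c j else if j = i + 2 then m else if j = i + 3 then r else c (j - 2)

section insertJog

variable {c : ℕ → ℤ} {i : ℕ} {m r : ℤ}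

theorem insertJog_of_le {j : ℕ} (h : j ≤ i + 1) : insertJog c i m r j = c j := if_pos h

@[simp] theorem insertJog_add_two : insertJog c i m r (i + 2) = m := by simp [insertJog]

@[simp] theorem insertJog_add_three : insertJog c i m r (i + 3) = r := by simp [insertJog]

theorem insertJog_of_ge {j : ℕ} (h : i + 2 ≤ j) : insertJog c i m r (j + 2) = c j := by
  simp only [insertJog]
  rw [if_neg (by omega), if_neg (by omega), if_neg (by omega), Nat.add_sub_cancel]

theorem IsRealization.jog {d : ℕ → ℤ} {α β : List Turn} {n : ℕ} (h : IsRealization c (α ++ β))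
    (hlo : ∀ j ≤ i + 1, d j = c j) (d2 : d (i + 2) = m) (d3 : d (i + 3) = r)
    (hhi : ∀ j, i + 2 ≤ j → d (j + 2) = c j)
    (hi : α.length = i) (hn : (α ++ β).length = n)
    (hm : min (c i) (c (i + 2)) < m ∧ m < max (c i) (c (i + 2)))
    (hmf : ∀ j ≤ n + 2, j % 2 = i % 2 → c j ≠ m)
    (hr : r = c (i + 1) + 1 ∨ r = c (i + 1) - 1)
    (hrf : ∀ j ≤ n + 2, j % 2 = (i + 1) % 2 → c j ≠ r)
    {t t' : Turn} (htt : t ≠ t')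
    (ht : (c i < c (i + 2) ↔ c (i + 1) < r) ↔ (t.toNat + i) % 2 = 0) :
    IsRealization d (α ++ [t, t'] ++ β) := by
  have hin : i ≤ n := by rw [← hn, List.length_append]; omega
  have hlen : (α ++ [t, t'] ++ β).length = n + 2 := by
    rw [← hn]; simp only [List.length_append, List.length_cons, List.length_nil]; omega
  have d0 : d i = c i := hlo i (by omega)
  have d1 : d (i + 1) = c (i + 1) := hlo (i + 1) le_rfl
  have d4 : d (i + 4) = c (i + 2) := hhi (i + 2) le_rfl
  have d5 : d (i + 5) = c (i + 3) := hhi (i + 3) (by omega)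
  have hne0 := h.ne i (by omega)
  have hx0 := hmf i (by omega) rfl
  have hx2 := hmf (i + 2) (by omega) (by omega)
  have hy1 := hrf (i + 1) (by omega) rfl
  refine ⟨fun p hp => ?_, fun p s hs => ?_, ?_⟩
  · rcases Nat.lt_or_ge p i with h' | h'
    · rw [hlo _ (by omega), hlo _ (by omega)]
      exact h.ne p (by omega)
    obtain rfl | rfl | rfl | rfl | h'' : p = i ∨ p = i + 1 ∨ p = i + 2 ∨ p = i + 3 ∨ i + 4 ≤ p := by
      omega
    · omega
    · simp only [add_assoc, Nat.reduceAdd]; omega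
    · simp only [add_assoc, Nat.reduceAdd]; omega
    · have := hrf (i + 3) (by omega) (by omega)
      simp only [add_assoc, Nat.reduceAdd]; omega
    · obtain ⟨q, rfl⟩ : ∃ q, p = q + 2 := ⟨p - 2, by omega⟩
      rw [hhi _ (by omega), hhi _ (by omega)]
      exact h.ne q (by omega)
  · have hpl : p < n + 2 := hlen ▸ (List.getElem?_eq_some_iff.1 hs).1
    rcases Nat.lt_or_ge p i with h' | h'
    · have hs' : (α ++ β)[p]? = some s := by
        rw [List.append_assoc, List.getElem?_append_left (by omega)] at hs
        rwa [List.getElem?_append_left (by omega)]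
      have := h.turn p s hs'
      unfold TurnOK at this ⊢
      rcases Nat.lt_or_ge (p + 1) i with h'' | h''
      · rwa [hlo _ (by omega), hlo _ (by omega),
          hlo _ (by omega), hlo _ (by omega)]
      · obtain rfl : i = p + 1 := by omega
        have e0 : d p = c p := hlo _ (by omega)
        simp only [add_assoc, Nat.reduceAdd] at *
        omega
    obtain rfl | rfl | h'' : p = i ∨ p = i + 1 ∨ i + 2 ≤ p := by omega
    · have : s = t := by
        rw [List.append_assoc, List.getElem?_append_right (by omega)] at hs
        simpa [hi, eq_comm] using hs
      subst this
      unfold TurnOK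
      omega
    · have : s = t' := by
        rw [List.append_assoc, List.getElem?_append_right (by omega)] at hs
        simpa [hi, eq_comm] using hs
      subst this
      unfold TurnOK
      simp only [add_assoc, Nat.reduceAdd]
      have : t.toNat + s.toNat = 1 := by cases t <;> cases s <;> simp_all [Turn.toNat]
      omega
    · obtain ⟨q, rfl⟩ : ∃ q, p = q + 2 := ⟨p - 2, by omega⟩
      have hs' : (α ++ β)[q]? = some s := by
        rw [List.getElem?_append_right (by simp; omega)] at hs
        rw [List.getElem?_append_right (by omega)]
        convert hs using 2
        simp only [List.length_append, List.length_cons, List.length_nil]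
        omega
      have := h.turn q s hs'
      unfold TurnOK at this ⊢
      obtain rfl | h'' : q = i ∨ i + 1 ≤ q := by omega
      · have f := hrf (q + 3) (by omega) (by omega)
        have := h.ne (q + 1) (by omega)
        simp only [add_assoc, Nat.reduceAdd] at *
        omega
      · have e3 : d (q + 2 + 1) = c (q + 1) := hhi (q + 1) (by omega)
        have e4 : d (q + 2 + 2) = c (q + 2) := hhi (q + 2) (by omega)
        have e5 : d (q + 2 + 3) = c (q + 3) := hhi (q + 3) (by omega)
        rw [e3, e4, e5]
        obtain rfl | h'' : q = i + 1 ∨ i + 2 ≤ q := by omega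
        · have f := hrf (i + 3) (by omega) (by omega)
          have := h.ne (i + 1) (by omega)
          simp only [add_assoc, Nat.reduceAdd] at *
          rw [d3]
          omega
        · rw [hhi _ h'']
          omega
  · have old : ∀ j k, j ≤ n → (j < i ∨ i + 2 ≤ j) → k % 2 = j % 2 → d k = c j →
        d (k + 1) = c (j + 1) → d (k + 2) = c (j + 2) →
        (j + 1 ≠ i → SegDisjoint d k i) ∧ SegDisjoint d k (i + 1) ∧ SegDisjoint d k (i + 2) ∧
        (j ≠ i + 2 → i + 1 ≤ n → SegDisjoint d k (i + 3)) := by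
      intro j k hjn hj hk e0 e1 e2
      have hA : j + 1 ≠ i → SegDisjoint c j i := fun h' => by
        rcases hj with hj | hj
        · exact h.disj j i (by omega) (by omega)
        · exact (h.disj i j (by omega) (by omega)).symm
      have hB : j ≠ i + 2 → i + 1 ≤ n → SegDisjoint c j (i + 1) := fun h' h'' => by
        rcases hj with hj | hj
        · exact h.disj j (i + 1) (by omega) (by omega)
        · exact (h.disj (i + 1) j (by omega) (by omega)).symm
      have f1 := hmf (j + 1) (by omega)
      have g0 := hrf j (by omega)
      have g1 := hrf (j + 1) (by omega)
      have g2 := hrf (j + 2) (by omega)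
      unfold SegDisjoint
      simp only [add_assoc, Nat.reduceAdd]
      rw [e0, e1, e2, d0, d1, d2, d3, d4, d5]
      refine ⟨fun h' => ⟨fun hp => ?_, fun hp => ?_⟩, ⟨fun hp he => ?_, fun hp => ?_⟩,
        ⟨fun hp he => ?_, fun hp => ?_⟩, fun h' h'' => ⟨fun hp => ?_, fun hp => ?_⟩⟩
      · exact par_shrink hm ((hA h').1 (by omega))
      · exact perp_shrink hm ((hA h').2 (by omega))
      · exact absurd he (f1 (by omega))
      · exact perp_step hm hr (g1 (by omega)) ((hA (by omega)).1 (by omega))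
      · exact absurd he (g1 (by omega))
      · rcases eq_or_ne (j + 1) i with h' | h'
        · rw [h']
          clear * - hm
          omega
        · exact perp_shift hm hr (g0 (by omega)) (g2 (by omega)) ((hA h').2 (by omega))
      · exact par_extend hr (g0 (by omega)) (g2 (by omega)) ((hB h' h'').1 (by omega))
      · exact perp_extend hr (g1 (by omega)) ((hB h' h'').2 (by omega))
    have new02 : SegDisjoint d i (i + 2) := by
      constructor
      · intro hp he
        simp only [add_assoc, Nat.reduceAdd] at *
        omega
      · intro hp
        omega
    have new03 : SegDisjoint d i (i + 3) := by
      constructor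
      · intro hp he
        omega
      · intro hp
        simp only [add_assoc, Nat.reduceAdd]
        rw [d0, d1, d2, d3, d4, d5]
        clear * - hm
        omega
    have new13 : SegDisjoint d (i + 1) (i + 3) := by
      constructor
      · intro hp he
        simp only [add_assoc, Nat.reduceAdd] at *
        omega
      · intro hp
        omega
    have eqs : ∀ q, i + 2 ≤ q → d (q + 2) = c q ∧ d (q + 3) = c (q + 1) ∧ d (q + 4) = c (q + 2) :=
      fun q hq => ⟨hhi _ hq, hhi (q + 1) (by omega),
        hhi (q + 2) (by omega)⟩
    have eqs' : ∀ q, q < i → d q = c q ∧ d (q + 1) = c (q + 1) ∧ d (q + 2) = c (q + 2) :=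
      fun q hq => ⟨hlo _ (by omega), hlo _ (by omega),
        hlo _ (by omega)⟩
    intro p q hpq hq
    rw [hlen] at hq
    have hsplit : ∀ p, p < i ∨ p = i ∨ p = i + 1 ∨ p = i + 2 ∨ p = i + 3 ∨
        ∃ p', p = p' + 2 ∧ i + 2 ≤ p' := fun p => by
      rcases Nat.lt_or_ge p (i + 4) with h' | h'
      · omega
      · exact Or.inr <| Or.inr <| Or.inr <| Or.inr <| Or.inr ⟨p - 2, by omega, by omega⟩
    rcases hsplit p with hp | hp
    · obtain ⟨e0, e1, e2⟩ := eqs' p hp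
      obtain ⟨o0, o1, o2, o3⟩ := old p p (by omega) (Or.inl hp) rfl e0 e1 e2
      rcases hsplit q with hq | rfl | rfl | rfl | rfl | ⟨q, rfl, hq'⟩
      · obtain ⟨e0', e1', e2'⟩ := eqs' q hq
        have := h.disj p q (by omega) (by omega)
        unfold SegDisjoint at this ⊢
        rwa [e0, e1, e2, e0', e1', e2']
      · exact o0 (by omega)
      · exact o1
      · exact o2
      · exact o3 (by omega) (by omega)
      · obtain ⟨e0', e1', e2'⟩ := eqs q hq'
        have := h.disj p q (by omega) (by omega)
        unfold SegDisjoint at this ⊢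
        rwa [e0, e1, e2, e0', e1', e2', Nat.add_mod_right]
    · rcases hsplit q with hq' | rfl | rfl | rfl | rfl | ⟨q, rfl, hq'⟩
      · omega
      · omega
      · omega
      · obtain rfl : p = i := by omega
        exact new02
      · obtain rfl | rfl : p = i ∨ p = i + 1 := by omega
        · exact new03
        · exact new13
      · obtain ⟨e0', e1', e2'⟩ := eqs q hq'
        obtain ⟨o0, o1, o2, o3⟩ := old q (q + 2) (by omega) (Or.inr hq') (by omega) e0' e1' e2'
        rcases hp with rfl | rfl | rfl | rfl | ⟨p, rfl, hp⟩
        · exact (o0 (by omega)).symm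
        · exact o1.symm
        · exact o2.symm
        · exact (o3 (by omega) (by omega)).symm
        · obtain ⟨e0, e1, e2⟩ := eqs p hp
          have := h.disj p q (by omega) (by omega)
          unfold SegDisjoint at this ⊢
          rwa [e0, e1, e2, e0', e1', e2', Nat.add_mod_right, Nat.add_mod_right]

end insertJog

/-- The abscissa `x` lies outside the closed interval from `-a` to `0`. -/
def Outer (a x : ℤ) : Prop := x < -a ∨ 0 < x

/-- The `i`-th segment leaves the strip between the abscissas `-a` and `0`. -/
def FreeSeg (a : ℤ) (c : ℕ → ℤ) (i : ℕ) : Prop :=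
  (i % 2 = 1 → Outer a (c (i + 1))) ∧ (i % 2 = 0 → Outer a (c i) ∨ Outer a (c (i + 2)))

/-- A realization from `(0, 0)` to `(-a, 0)` such that each segment except the last one leaves the
strip between the abscissas `-a` and `0`, or lies between two left turns and both its neighbours
leave the strip. -/
structure IsFlexible (a : ℤ) (c : ℕ → ℤ) (σ : List Turn) : Prop extends IsRealization c σ where
  zero : c 0 = 0
  one : c 1 = 0
  two_pos : 0 < c 2
  last_x : c (σ.length + 1) = -a
  last_y : c (σ.length + 2) = 0
  flex : ∀ i < σ.length, FreeSeg a c i ∨ ∃ k, i = k + 1 ∧ k + 2 < σ.length ∧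
    σ[k]? = some Turn.L ∧ σ[k + 1]? = some Turn.L ∧ FreeSeg a c k ∧ FreeSeg a c (k + 2)

/-- Dilate the plane by a factor three outside the strip between the abscissas `-a` and `0`. -/
theorem IsFlexible.stretch {a : ℤ} {c : ℕ → ℤ} {σ : List Turn} (h : IsFlexible a c σ) (ha : 0 ≤ a)
    (hodd : σ.length % 2 = 1) : ∃ d, IsFlexible a d σ ∧ (∀ i, FreeSeg a c i → FreeSeg a d i) ∧
      (∀ j k, j % 2 = k % 2 → (j % 2 = 0 → Outer a (d j)) → d k ≠ d j + 1 ∧ d k ≠ d j - 1) ∧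
      (∀ j, j % 2 = 0 → Outer a (d j) → Outer a (d j + 1) ∧ Outer a (d j - 1)) := by
  let f : ℤ → ℤ := fun x => if x < -a then 3 * (x + a) - a else if 0 < x then 3 * x else x
  let d : ℕ → ℤ := fun i => if i % 2 = 0 then f (c i) else 3 * c i
  have hd0 : ∀ i, i % 2 = 0 → d i = f (c i) := fun i hi => if_pos hi
  have hd1 : ∀ i, i % 2 = 1 → d i = 3 * c i := fun i hi => if_neg (by omega)
  have hf : ∀ x y, f x < f y ↔ x < y := fun x y => by simp only [f]; split_ifs <;> omega
  have hout : ∀ x, Outer a x → Outer a (f x) := fun x hx => by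
    simp only [f, Outer] at *; split_ifs <;> omega
  have hfree : ∀ i, FreeSeg a c i → FreeSeg a d i := fun i hi => by
    refine ⟨fun hp => ?_, fun hp => ?_⟩
    · rw [hd0 _ (by omega)]
      exact hout _ (hi.1 hp)
    · rw [hd0 _ hp, hd0 _ (by omega)]
      exact (hi.2 hp).imp (hout _) (hout _)
  refine ⟨d, ⟨h.toIsRealization.of_lt_iff_lt fun i j hij => ?_, ?_, ?_, ?_, ?_, ?_, ?_⟩, hfree, ?_, ?_⟩
  · rcases Nat.mod_two_eq_zero_or_one i with hp | hp
    · rw [hd0 _ hp, hd0 _ (by omega), hf]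
    · rw [hd1 _ hp, hd1 _ (by omega)]
      omega
  · rw [hd0 _ rfl, h.zero]
    simp only [f]; split_ifs <;> omega
  · rw [hd1 _ rfl, h.one, mul_zero]
  · have := h.two_pos
    rw [hd0 _ rfl]
    simp only [f]; split_ifs <;> omega
  · rw [hd0 _ (by omega), h.last_x]
    simp only [f]; split_ifs <;> omega
  · rw [hd1 _ (by omega), h.last_y, mul_zero]
  · intro i hi
    rcases h.flex i hi with h' | ⟨k, h1, h2, h3, h4, h5, h6⟩
    · exact Or.inl (hfree _ h')
    · exact Or.inr ⟨k, h1, h2, h3, h4, hfree _ h5, hfree _ h6⟩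
  · intro j k hjk ho
    rcases Nat.mod_two_eq_zero_or_one j with hp | hp
    · have := ho hp
      rw [hd0 _ hp] at this ⊢
      rw [hd0 _ (by omega)]
      simp only [f, Outer] at *
      split_ifs at * <;> omega
    · rw [hd1 _ hp, hd1 _ (by omega)]
      omega
  · intro j hp ho
    rw [hd0 _ hp] at ho ⊢
    simp only [f, Outer] at *
    split_ifs at * <;> omega

theorem IsFlexible.jog_of_free {a : ℤ} {c : ℕ → ℤ} {α β : List Turn} (h : IsFlexible a c (α ++ β))
    (ha : 0 ≤ a) (hodd : (α ++ β).length % 2 = 1) (hβ : β ≠ []) (hfree : FreeSeg a c α.length)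
    {t t' : Turn} (htt : t ≠ t') : ∃ d, IsFlexible a d (α ++ [t, t'] ++ β) := by
  obtain ⟨c, h, hc, hgap, hout⟩ := h.stretch ha hodd
  replace hfree := hc _ hfree
  clear hc
  obtain ⟨i, hi⟩ : ∃ i, α.length = i := ⟨_, rfl⟩
  obtain ⟨n, hn⟩ : ∃ n, (α ++ β).length = n := ⟨_, rfl⟩
  have hin : i < n := by
    have := List.length_pos_iff.2 hβ
    rw [List.length_append] at hn
    omega
  have hlen : (α ++ [t, t'] ++ β).length = n + 2 := by
    rw [← hn]; simp only [List.length_append, List.length_cons, List.length_nil]; omega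
  have hne := h.ne i (by omega)
  rw [hi] at hfree
  obtain ⟨hf1, hf0⟩ := hfree
  obtain ⟨r, hr, hrt⟩ : ∃ r, (r = c (i + 1) + 1 ∨ r = c (i + 1) - 1) ∧
      ((c i < c (i + 2) ↔ c (i + 1) < r) ↔ (t.toNat + i) % 2 = 0) := by
    by_cases hlt : c i < c (i + 2) ↔ (t.toNat + i) % 2 = 0
    · exact ⟨c (i + 1) + 1, by omega, by omega⟩
    · exact ⟨c (i + 1) - 1, by omega, by omega⟩
  have hrf : ∀ j, j % 2 = (i + 1) % 2 → c j ≠ r := fun j hj => by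
    have := hgap (i + 1) j hj.symm (fun hp => hf1 (by omega))
    omega
  obtain ⟨m, hm, hmf, hmo⟩ : ∃ m, (min (c i) (c (i + 2)) < m ∧ m < max (c i) (c (i + 2))) ∧
      (∀ j, j % 2 = i % 2 → c j ≠ m) ∧ (i % 2 = 0 → Outer a m) := by
    have near : ∀ k l : ℕ, k % 2 = i % 2 → l % 2 = i % 2 → c k ≠ c l →
        (i % 2 = 0 → Outer a (c k)) →
        ∃ m, (min (c k) (c l) < m ∧ m < max (c k) (c l)) ∧
          (∀ j, j % 2 = i % 2 → c j ≠ m) ∧ (i % 2 = 0 → Outer a m) := by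
      intro k l hk hl hkl ho
      have g := fun j (hj : j % 2 = i % 2) => hgap k j (by omega) (fun hp => ho (by omega))
      have gl := g l hl
      rcases lt_or_gt_of_ne hkl with hlt | hlt
      · exact ⟨c k + 1, by omega, fun j hj => (g j hj).1,
          fun h0 => (hout k (by omega) (ho h0)).1⟩
      · exact ⟨c k - 1, by omega, fun j hj => (g j hj).2,
          fun h0 => (hout k (by omega) (ho h0)).2⟩
    by_cases hp : i % 2 = 0 ∧ ¬ Outer a (c i)
    · have := near (i + 2) i (by omega) rfl hne.symm fun h0 => (hf0 h0).resolve_left hp.2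
      rwa [min_comm, max_comm] at this
    · exact near i (i + 2) rfl (by omega) hne fun h0 => by_contra fun h1 => hp ⟨h0, h1⟩
  set d := insertJog c i m r with hd
  have hlo : ∀ j ≤ i + 1, d j = c j := fun j hj => insertJog_of_le hj
  have d2 : d (i + 2) = m := insertJog_add_two
  have d3 : d (i + 3) = r := insertJog_add_three
  have hhi : ∀ j, i + 2 ≤ j → d (j + 2) = c j := fun j hj => insertJog_of_ge hj
  have hreal := h.toIsRealization.jog hlo d2 d3 hhi hi hn hm (fun j _ => hmf j) hr
    (fun j _ => hrf j) htt hrt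
  clear_value d
  have h2 : d 2 = c 2 ∨ d 2 = m ∧ i = 0 := by
    rcases Nat.eq_zero_or_pos i with rfl | hpos
    · exact Or.inr ⟨d2, rfl⟩
    · exact Or.inl (hlo 2 (by omega))
  have hx : d (n + 3) = c (n + 1) := hhi (n + 1) (by omega)
  have hy : d (n + 4) = c (n + 2) := hhi (n + 2) (by omega)
  have free0 : FreeSeg a d i := by
    refine ⟨fun hp => ?_, fun hp => Or.inr ?_⟩
    · rw [hlo _ le_rfl]
      exact hf1 hp
    · rw [d2]
      exact hmo hp
  have free1 : FreeSeg a d (i + 1) := by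
    refine ⟨fun hp => ?_, fun hp => Or.inl ?_⟩
    · rw [d2]
      exact hmo (by omega)
    · rw [hlo _ le_rfl]
      exact hf1 (by omega)
  have hor : i % 2 = 1 → Outer a r := fun hp => by
    have := hout (i + 1) (by omega) (hf1 hp)
    rcases hr with rfl | rfl
    · exact this.1
    · exact this.2
  have free2 : FreeSeg a d (i + 2) := by
    refine ⟨fun hp => ?_, fun hp => Or.inl ?_⟩
    · rw [d3]
      exact hor (by omega)
    · rw [d2]
      exact hmo (by omega)
  have before : ∀ j, j ≤ i → FreeSeg a c j → FreeSeg a d j := by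
    intro j hj hf
    rcases hj.eq_or_lt with rfl | hj
    · exact free0
    · rwa [FreeSeg, hlo _ (by omega), hlo _ (by omega), hlo _ (by omega)]
  have after : ∀ j, i ≤ j → FreeSeg a c j → FreeSeg a d (j + 2) := by
    intro j hj hf
    obtain rfl | rfl | hj : j = i ∨ j = i + 1 ∨ i + 2 ≤ j := by omega
    · exact free2
    · refine ⟨fun hp => ?_, fun hp => Or.inl ?_⟩
      · rw [hhi (i + 2) le_rfl]
        exact hf.1 (by omega)
      · rw [show i + 1 + 2 = i + 3 from rfl, d3]
        exact hor (by omega)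
    · have e0 := hhi j hj
      have e1 : d (j + 2 + 1) = c (j + 1) := hhi (j + 1) (by omega)
      have e2 : d (j + 2 + 2) = c (j + 2) := hhi (j + 2) (by omega)
      rwa [FreeSeg, e0, e1, e2, Nat.add_mod_right]
  have letter_lo : ∀ k < i, (α ++ [t, t'] ++ β)[k]? = (α ++ β)[k]? := fun k hk => by
    rw [List.append_assoc, List.getElem?_append_left (by omega),
      List.getElem?_append_left (by omega)]
  have letter_hi : ∀ k, i ≤ k → (α ++ [t, t'] ++ β)[k + 2]? = (α ++ β)[k]? := fun k hk => by
    rw [List.getElem?_append_right (by simp; omega), List.getElem?_append_right (by omega)]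
    congr 1
    simp only [List.length_append, List.length_cons, List.length_nil]
    omega
  refine ⟨d, hreal, ?_, ?_, ?_, ?_, ?_, ?_⟩
  · rw [hlo _ (by omega), h.zero]
  · rw [hlo _ (by omega), h.one]
  · have := h.two_pos
    have := h.zero
    rcases h2 with h2 | ⟨h2, rfl⟩
    · omega
    · simp only [zero_add] at *
      omega
  · rw [hlen, hx, ← hn, h.last_x]
  · rw [hlen, hy, ← hn, h.last_y]
  · rw [hlen]
    intro j hj
    rcases Nat.lt_or_ge j i with hji | hji
    · rcases h.flex j (by omega) with hf | ⟨k, h1, h2, h3, h4, h5, h6⟩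
      · exact Or.inl (before j hji.le hf)
      · exact Or.inr ⟨k, h1, by omega, by rwa [letter_lo _ (by omega)],
          by rwa [letter_lo _ (by omega)], before k (by omega) h5, before (k + 2) (by omega) h6⟩
    · obtain rfl | rfl | hji : j = i ∨ j = i + 1 ∨ i + 2 ≤ j := by omega
      · exact Or.inl free0
      · exact Or.inl free1
      · obtain ⟨j, rfl⟩ : ∃ j', j = j' + 2 := ⟨j - 2, by omega⟩
        rcases h.flex j (by omega) with hf | ⟨k, h1, h2, h3, h4, h5, h6⟩
        · exact Or.inl (after j (by omega) hf)
        · rcases eq_or_ne j i with rfl | hne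
          · exact Or.inl free2
          · exact Or.inr ⟨k + 2, by omega, by omega, by rwa [letter_hi _ (by omega)],
              by rw [show k + 2 + 1 = k + 1 + 2 from rfl]; rwa [letter_hi _ (by omega)],
              after k (by omega) h5, after (k + 2) (by omega) h6⟩

/-- A jog can be inserted anywhere except in the last segment. -/
theorem IsFlexible.jog {a : ℤ} {c : ℕ → ℤ} {α β : List Turn} (h : IsFlexible a c (α ++ β))
    (ha : 0 ≤ a) (hodd : (α ++ β).length % 2 = 1) (hβ : β ≠ [])
    {t t' : Turn} (htt : t ≠ t') : ∃ d, IsFlexible a d (α ++ [t, t'] ++ β) := by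
  have hin : α.length < (α ++ β).length := by
    have := List.length_pos_iff.2 hβ
    rw [List.length_append]
    omega
  rcases h.flex α.length hin with hf | ⟨k, h1, h2, h3, h4, h5, h6⟩
  · exact h.jog_of_free ha hodd hβ hf htt
  · obtain ⟨α, x, rfl⟩ : ∃ α' x, α = α' ++ [x] :=
      ⟨_, _, (List.dropLast_append_getLast (by rintro rfl; simp at h1)).symm⟩
    obtain ⟨y, β, rfl⟩ := List.exists_cons_of_ne_nil hβ
    obtain rfl : k = α.length := by simpa using h1.symm
    obtain rfl : x = Turn.L := by simpa using h3
    obtain rfl : y = Turn.L := by simpa using h4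
    cases t <;> cases t' <;> try exact absurd rfl htt
    · have hβ' : β ≠ [] := by
        rintro rfl
        simp at h2
      have := IsFlexible.jog_of_free (α := α ++ [Turn.L, Turn.L]) (β := β) (a := a) (c := c)
        (by simpa using h) ha (by simpa using hodd) hβ' (by simpa using h6)
        (t := Turn.R) (t' := Turn.L) (by simp)
      simpa using this
    · have := IsFlexible.jog_of_free (α := α) (β := Turn.L :: Turn.L :: β) (a := a) (c := c)
        (by simpa using h) ha (by simpa using hodd) (by simp) h5
        (t := Turn.L) (t' := Turn.R) (by simp)
      simpa using this

/-- The first `4 * k + 4` coordinates describe a counterclockwise outward spiral. -/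
def IsSpiral (k : ℕ) (c : ℕ → ℤ) : Prop :=
  ∀ q : ℕ, q ≤ k → c (4 * q) = -q ∧ c (4 * q + 1) = -q ∧ c (4 * q + 2) = q + 1 ∧
    c (4 * q + 3) = q + 2

theorem IsSpiral.exists (k : ℕ) (t : ℕ → ℤ) :
    ∃ c, IsSpiral k c ∧ ∀ j, c (4 * k + 4 + j) = t j := by
  refine ⟨fun i => if i < 4 * k + 4 then
      if (i / 2) % 2 = 0 then -((i / 4 : ℕ) : ℤ) else ((i / 4 : ℕ) : ℤ) + 1 + ((i % 2 : ℕ) : ℤ)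
    else t (i - (4 * k + 4)), fun q hq => ⟨?_, ?_, ?_, ?_⟩, fun j => ?_⟩ <;>
  simp only
  any_goals split_ifs <;> omega
  rw [if_neg (by omega), Nat.add_sub_cancel_left]

theorem IsSpiral.eq_or {k : ℕ} {c : ℕ → ℤ} (h : IsSpiral k c) {i : ℕ} (hi : i ≤ 4 * k + 1) :
    ∃ q : ℕ, q ≤ k ∧
      ((i = 4 * q ∧ c i = -q ∧ c (i + 1) = -q ∧ c (i + 2) = q + 1) ∨
      (i = 4 * q + 1 ∧ c i = -q ∧ c (i + 1) = q + 1 ∧ c (i + 2) = q + 2) ∨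
      (i = 4 * q + 2 ∧ q < k ∧ c i = q + 1 ∧ c (i + 1) = q + 2 ∧ c (i + 2) = -q - 1) ∨
      (i = 4 * q + 3 ∧ q < k ∧ c i = q + 2 ∧ c (i + 1) = -q - 1 ∧ c (i + 2) = -q - 1)) := by
  refine ⟨i / 4, by omega, ?_⟩
  obtain ⟨q, hq⟩ : ∃ q, i / 4 = q := ⟨_, rfl⟩
  rw [hq]
  obtain ⟨h0, h1, h2, h3⟩ := h q (by omega)
  obtain hr | hr | hr | hr : i = 4 * q ∨ i = 4 * q + 1 ∨ i = 4 * q + 2 ∨ i = 4 * q + 3 := by omega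
  · subst hr
    exact Or.inl ⟨rfl, h0, h1, h2⟩
  · subst hr
    exact Or.inr (Or.inl ⟨rfl, h1, h2, h3⟩)
  · obtain ⟨h4, h5, -⟩ := h (q + 1) (by omega)
    subst hr
    simp only [mul_add, mul_one, add_assoc, Nat.reduceAdd] at h4 h5 ⊢
    exact Or.inr (Or.inr (Or.inl ⟨trivial, by omega, h2, h3, by omega⟩))
  · obtain ⟨h4, h5, -⟩ := h (q + 1) (by omega)
    subst hr
    simp only [mul_add, mul_one, add_assoc, Nat.reduceAdd] at h4 h5 ⊢
    exact Or.inr (Or.inr (Or.inr ⟨trivial, by omega, h3, by omega, by omega⟩))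

theorem IsSpiral.isRealization {k : ℕ} {c : ℕ → ℤ} (h : IsSpiral k c) :
    IsRealization c (List.replicate (4 * k + 1) Turn.L) where
  ne i hi := by
    obtain ⟨q, hq, h⟩ := h.eq_or (by simpa using hi)
    omega
  turn i t ht := by
    obtain ⟨hi, rfl⟩ := by simpa [List.getElem?_replicate] using ht
    obtain ⟨q, hq, h1⟩ := h.eq_or (i := i) (by omega)
    obtain ⟨q', hq', h2⟩ := h.eq_or (i := i + 1) (by omega)
    simp only [add_assoc, Nat.reduceAdd] at h2
    simp only [TurnOK, Turn.toNat]
    omega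
  disj i j hij hj := by
    rw [List.length_replicate] at hj
    obtain ⟨q, hq, h1⟩ := h.eq_or (i := i) (by omega)
    obtain ⟨q', hq', h2⟩ := h.eq_or (i := j) (by omega)
    constructor
    · intro hp he
      omega
    · intro hp
      omega

theorem IsRealization.concat_replicate {c : ℕ → ℤ} {n : ℕ}
    (h : IsRealization c (List.replicate n Turn.L)) (hne : c (n + 1) ≠ c (n + 3))
    (ht : TurnOK c n Turn.L) (hd : ∀ i < n, SegDisjoint c i (n + 1)) :
    IsRealization c (List.replicate (n + 1) Turn.L) := by
  rw [List.replicate_succ']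
  exact h.concat List.length_replicate hne ht hd

/-- The spiral can be continued by a westward and a southward segment. -/
theorem IsSpiral.isRealization_add_three {k : ℕ} {c : ℕ → ℤ} (h : IsSpiral k c)
    (hx : c (4 * k + 4) < -k) (hy : c (4 * k + 5) < k + 2) :
    IsRealization c (List.replicate (4 * k + 3) Turn.L) := by
  obtain ⟨h0, h1, h2, h3⟩ := h k le_rfl
  refine (h.isRealization.concat_replicate ?_ ?_ fun i hi => ?_).concat_replicate
    ?_ ?_ fun i hi => ?_ <;> simp only [add_assoc, Nat.reduceAdd, TurnOK, Turn.toNat]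
  any_goals omega
  · obtain ⟨q, hq, hi⟩ := h.eq_or hi.le
    simp only [SegDisjoint, add_assoc, Nat.reduceAdd]
    omega
  · obtain ⟨q, hq, hi⟩ := h.eq_or (i := i) (by omega)
    simp only [SegDisjoint, add_assoc, Nat.reduceAdd]
    omega

theorem IsSpiral.isFlexible {k : ℕ} {c : ℕ → ℤ} (h : IsSpiral k c) {τ : List Turn}
    (hr : IsRealization c (List.replicate (4 * k + 3) Turn.L ++ τ))
    (hx : c (4 * k + 4 + τ.length) = -(k + 1)) (hy : c (4 * k + 5 + τ.length) = 0)
    (hfree : ∀ j < τ.length, FreeSeg (k + 1) c (4 * k + 3 + j)) :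
    IsFlexible (k + 1) c (List.replicate (4 * k + 3) Turn.L ++ τ) where
  toIsRealization := hr
  zero := by simpa using (h 0 (by omega)).1
  one := by simpa using (h 0 (by omega)).2.1
  two_pos := by
    have := (h 0 (by omega)).2.2.1
    simp only [mul_zero, zero_add] at this
    omega
  last_x := by
    rw [← hx, List.length_append, List.length_replicate]
    congr 1
    omega
  last_y := by
    rw [← hy, List.length_append, List.length_replicate]
    congr 1
    omega
  flex i hi := by
    rw [List.length_append, List.length_replicate] at hi
    have hL : ∀ j < 4 * k + 3, (List.replicate (4 * k + 3) Turn.L ++ τ)[j]? = some Turn.L := by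
      intro j hj
      rw [List.getElem?_append_left (by simpa using hj), List.getElem?_replicate, if_pos hj]
    rcases Nat.lt_or_ge (4 * k + 2) i with h' | h'
    · obtain ⟨j, rfl⟩ := Nat.exists_eq_add_of_lt h'
      have := hfree j (by omega)
      rw [show 4 * k + 2 + j + 1 = 4 * k + 3 + j by omega]
      exact Or.inl this
    have hE : ∀ q ≤ k, FreeSeg (k + 1) c (4 * q + 2) := fun q hq =>
      ⟨by omega, fun _ => Or.inl (Or.inr (by have := h q hq; omega))⟩
    obtain ⟨q, hq⟩ : ∃ q, i / 4 = q := ⟨_, rfl⟩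
    have hq' := h q (by omega)
    obtain rfl | rfl | rfl | rfl :
      i = 4 * q ∨ i = 4 * q + 1 ∨ i = 4 * q + 2 ∨ i = 4 * q + 3 := by omega
    · exact Or.inl ⟨by omega, fun _ => Or.inr (Or.inr (by omega))⟩
    · exact Or.inl ⟨fun _ => Or.inr (by simp only [add_assoc, Nat.reduceAdd]; omega), by omega⟩
    · exact Or.inl (hE q (by omega))
    · refine Or.inr ⟨4 * q + 2, rfl, ?_, hL _ (by omega), hL _ (by omega), hE q (by omega),
        by omega, fun _ => Or.inr (Or.inr ?_)⟩
      · rw [List.length_append, List.length_replicate]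
        omega
      · have := (h (q + 1) (by omega)).2.2.1
        simp only [mul_add, mul_one, add_assoc, Nat.reduceAdd] at this ⊢
        omega

theorem exists_isFlexible_replicate_three (k : ℕ) :
    ∃ c, IsFlexible (k + 1) c (List.replicate (4 * k + 3) Turn.L) := by
  obtain ⟨c, h, ht⟩ := IsSpiral.exists k fun j => if j = 0 then -k - 1 else 0
  have t0 := ht 0
  have t1 := ht 1
  simp only [add_zero, add_assoc, Nat.reduceAdd, if_pos, one_ne_zero, if_false] at t0 t1
  have := h.isFlexible (τ := []) (by
    rw [List.append_nil]
    exact h.isRealization_add_three (by omega) (by omega)) (by simp [t0]; ring) (by simp [t1])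
    (by simp)
  rw [List.append_nil] at this
  exact ⟨c, this⟩

theorem exists_isFlexible_replicate_four (k : ℕ) (t : Turn) :
    ∃ c, IsFlexible (k + 1) c (List.replicate (4 * k + 3) Turn.L ++ [Turn.L, t]) := by
  obtain ⟨y, hy⟩ : ∃ y : ℤ, t.toNat = 0 ∧ y = -k - 1 ∨ t.toNat = 1 ∧ y = 1 := by
    cases t
    · exact ⟨_, Or.inl ⟨rfl, rfl⟩⟩
    · exact ⟨_, Or.inr ⟨rfl, rfl⟩⟩
  obtain ⟨c, h, ht⟩ := IsSpiral.exists k fun j =>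
    if j = 0 then -k - 2 else if j = 1 then y else if j = 2 then -k - 1 else 0
  have t0 := ht 0
  have t1 := ht 1
  have t2 := ht 2
  have t3 := ht 3
  simp only [add_assoc, Nat.reduceAdd, Nat.reduceEqDiff, if_true, if_false] at t0 t1 t2 t3
  obtain ⟨h0, h1, h2, h3⟩ := h k le_rfl
  refine ⟨c, h.isFlexible ?_ (t2.trans (by ring)) t3 ?_⟩
  · rw [List.append_cons]
    refine ((h.isRealization_add_three (by omega) (by omega)).concat List.length_replicate
      ?_ ?_ fun i hi => ?_).concat
      (by rw [List.length_append, List.length_replicate, List.length_singleton])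
      ?_ ?_ fun i hi => ?_ <;>
    simp only [add_assoc, Nat.reduceAdd, TurnOK, Turn.toNat.eq_1, SegDisjoint]
    any_goals omega
    all_goals
      obtain hi' | rfl | rfl : i ≤ 4 * k + 1 ∨ i = 4 * k + 2 ∨ i = 4 * k + 3 := by omega
      · obtain ⟨q, hq, hi⟩ := h.eq_or hi'
        omega
      all_goals
        simp only [add_assoc, Nat.reduceAdd]
        omega
  · intro j hj
    obtain rfl | rfl : j = 0 ∨ j = 1 := by simp at hj; omega
    all_goals
      simp only [FreeSeg, Outer, add_assoc, Nat.reduceAdd]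
      omega

set_option maxHeartbeats 1000000 in
/-- The spiral can be continued by a segment below it which turns back at its end. -/
theorem IsSpiral.isRealization_add_six {k : ℕ} {c : ℕ → ℤ} (h : IsSpiral k c)
    (h4 : c (4 * k + 4) = -k - 2) (h5 : c (4 * k + 5) = -k - 2) (h6 : c (4 * k + 6) = 1)
    (h7 : c (4 * k + 7) = -k - 1) (h8 : c (4 * k + 8) = -k - 1) :
    IsRealization c (List.replicate (4 * k + 6) Turn.L) := by
  obtain ⟨h0, h1, h2, h3⟩ := h k le_rfl
  refine (((h.isRealization_add_three (by omega) (by omega)).concat_replicate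
    ?_ ?_ fun i hi => ?_).concat_replicate ?_ ?_ fun i hi => ?_).concat_replicate
    ?_ ?_ fun i hi => ?_ <;>
  simp only [add_assoc, Nat.reduceAdd, TurnOK, Turn.toNat, SegDisjoint]
  any_goals omega
  all_goals
    obtain hi' | rfl | rfl | rfl | rfl : i ≤ 4 * k + 1 ∨ i = 4 * k + 2 ∨ i = 4 * k + 3 ∨
      i = 4 * k + 4 ∨ i = 4 * k + 5 := by omega
    · obtain ⟨q, hq, hi⟩ := h.eq_or hi'
      omega
    all_goals
      simp only [add_assoc, Nat.reduceAdd]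
      omega

set_option maxHeartbeats 1000000 in
theorem exists_isFlexible_replicate_six (k : ℕ) : ∃ c, IsFlexible (k + 1) c
    (List.replicate (4 * k + 3) Turn.L ++ [Turn.L, Turn.L, Turn.L, Turn.R]) := by
  obtain ⟨c, h, ht⟩ := IsSpiral.exists k fun j =>
    if j = 0 then -k - 2 else if j = 1 then -k - 2 else if j = 2 then 1 else
    if j = 5 then 0 else -k - 1
  have t0 := ht 0
  have t1 := ht 1
  have t2 := ht 2
  have t3 := ht 3
  have t4 := ht 4
  have t5 := ht 5
  simp only [add_assoc, Nat.reduceAdd, Nat.reduceEqDiff, if_true, if_false] at t0 t1 t2 t3 t4 t5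
  obtain ⟨h0, h1, h2, h3⟩ := h k le_rfl
  refine ⟨c, h.isFlexible ?_ (t4.trans (by ring)) t5 ?_⟩
  · have hl : List.replicate (4 * k + 3) Turn.L ++ [Turn.L, Turn.L, Turn.L, Turn.R] =
        List.replicate (4 * k + 6) Turn.L ++ [Turn.R] := by
      rw [show 4 * k + 6 = (4 * k + 3) + 3 by rfl, List.replicate_add (4 * k + 3) 3,
        List.append_assoc]
      rfl
    rw [hl]
    refine (h.isRealization_add_six t0 t1 t2 t3 t4).concat List.length_replicate ?_ ?_
      fun i hi => ?_ <;> simp only [add_assoc, Nat.reduceAdd, TurnOK, Turn.toNat, SegDisjoint]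
    any_goals omega
    obtain hi' | rfl | rfl | rfl | rfl : i ≤ 4 * k + 1 ∨ i = 4 * k + 2 ∨ i = 4 * k + 3 ∨
      i = 4 * k + 4 ∨ i = 4 * k + 5 := by omega
    · obtain ⟨q, hq, hi⟩ := h.eq_or hi'
      omega
    all_goals
      simp only [add_assoc, Nat.reduceAdd]
      omega
  · intro j hj
    obtain rfl | rfl | rfl | rfl : j = 0 ∨ j = 1 ∨ j = 2 ∨ j = 3 := by simp at hj; omega
    all_goals
      simp only [FreeSeg, Outer, add_assoc, Nat.reduceAdd]
      omega

theorem exists_append_or_eq_replicate (ρ : List Turn) :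
    (∃ α t t' β, t ≠ t' ∧ ρ = α ++ [t, t'] ++ β) ∨ ∃ m t, ρ = List.replicate m t := by
  induction ρ with
  | nil => exact Or.inr ⟨0, Turn.L, rfl⟩
  | cons s ρ ih =>
    rcases ih with ⟨α, t, t', β, h, rfl⟩ | ⟨m, t, rfl⟩
    · exact Or.inl ⟨s :: α, t, t', β, h, rfl⟩
    · rcases m with _ | m
      · exact Or.inr ⟨1, s, rfl⟩
      by_cases hs : s = t
      · exact Or.inr ⟨m + 2, s, by rw [hs]; rfl⟩
      · exact Or.inl ⟨[], s, t, List.replicate m t, hs, rfl⟩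

theorem excess_append (α β : List Turn) : excess (α ++ β) = excess α + excess β := by
  simp [excess, List.count_append]; ring

theorem excess_pair {t t' : Turn} (h : t ≠ t') : excess [t, t'] = 0 := by
  cases t <;> cases t' <;> simp_all [excess]

theorem excess_replicate_L (m : ℕ) : excess (List.replicate m Turn.L) = m := by
  simp [excess, List.count_replicate]

theorem excess_replicate_R (m : ℕ) : excess (List.replicate m Turn.R) = -m := by
  simp [excess, List.count_replicate]

theorem exists_isFlexible (σ : List Turn) (h3 : 3 ≤ excess σ) (hodd : excess σ % 2 = 1) :
    ∃ c, IsFlexible ((excess σ + 2) / 4) c σ := by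
  induction hn : σ.length using Nat.strong_induction_on generalizing σ with
  | _ n ih =>
    subst hn
    rcases List.eq_nil_or_concat' σ with rfl | ⟨ρ, s, rfl⟩
    · simp [excess] at h3
    rcases exists_append_or_eq_replicate ρ with ⟨α, t, t', β, htt, rfl⟩ | ⟨m, t, rfl⟩
    · have he : excess (α ++ [t, t'] ++ β ++ [s]) = excess (α ++ (β ++ [s])) := by
        simp only [excess_append, excess_pair htt]
        ring
      rw [he] at h3 hodd ⊢
      obtain ⟨c, hc⟩ := ih _ (by simp) _ h3 hodd rfl
      have := excess_emod_two (α ++ (β ++ [s]))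
      rw [List.append_assoc]
      exact hc.jog (by omega) (by omega) (by simp) htt
    · have he : ∀ k : ℕ, ∀ e : ℤ, e = 4 * k + 3 ∨ e = 4 * k + 5 → (e + 2) / 4 = k + 1 := by
        omega
      cases t <;> cases s
      · rw [excess_concat_L, excess_replicate_L] at h3 hodd ⊢
        obtain ⟨k, rfl | rfl⟩ : ∃ k, m = 4 * k + 2 ∨ m = 4 * k + 4 := ⟨(m - 2) / 4, by omega⟩
        · rw [he k _ (by omega), ← List.replicate_succ']
          exact exists_isFlexible_replicate_three k
        · rw [he k _ (by omega), ← List.replicate_succ']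
          have := exists_isFlexible_replicate_four k Turn.L
          rwa [show [Turn.L, Turn.L] = List.replicate 2 Turn.L by rfl,
            List.replicate_append_replicate] at this
      · rw [excess_concat_R, excess_replicate_L] at h3 hodd ⊢
        obtain ⟨k, rfl | rfl⟩ : ∃ k, m = 4 * k + 4 ∨ m = 4 * k + 6 := ⟨(m - 4) / 4, by omega⟩
        · rw [he k _ (by omega), List.replicate_succ', List.append_assoc]
          exact exists_isFlexible_replicate_four k Turn.R
        · rw [he k _ (by omega), show 4 * k + 6 = (4 * k + 3) + 3 by rfl,
            List.replicate_add (4 * k + 3) 3, List.append_assoc]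
          exact exists_isFlexible_replicate_six k
      · rw [excess_concat_L, excess_replicate_R] at h3
        omega
      · rw [excess_concat_R, excess_replicate_R] at h3
        omega

theorem IsRealization.congr {c d : ℕ → ℤ} {σ : List Turn} (h : IsRealization c σ)
    (hcd : ∀ i ≤ σ.length + 2, d i = c i) : IsRealization d σ where
  ne i hi := by
    rw [hcd i (by omega), hcd (i + 2) (by omega)]
    exact h.ne i hi
  turn i t ht := by
    have hi := (List.getElem?_eq_some_iff.1 ht).1
    unfold TurnOK
    rw [hcd i (by omega), hcd (i + 1) (by omega), hcd (i + 2) (by omega), hcd (i + 3) (by omega)]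
    exact h.turn i t ht
  disj i j hij hj := by
    unfold SegDisjoint
    rw [hcd i (by omega), hcd (i + 1) (by omega), hcd (i + 2) (by omega), hcd j (by omega),
      hcd (j + 1) (by omega), hcd (j + 2) (by omega)]
    exact h.disj i j hij hj

/-- A chain ending on the `-x`-axis with a vertical segment can be prolonged horizontally, moving
the endpoint by at most one unit. -/
theorem IsFlexible.exists_chain_concat {a : ℤ} {c : ℕ → ℤ} {σ : List Turn} (h : IsFlexible a c σ)
    (ha : 0 < a) (h2 : excess σ % 2 = 1) (t : Turn) :
    ∃ C : Chain (σ ++ [t]), C.pts ((σ ++ [t]).length + 1) =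
      (if excess (σ ++ [t]) % 4 = 0 then -a else -a - 1, 0) := by
  obtain ⟨n, hn⟩ : ∃ n, σ.length = n := ⟨_, rfl⟩
  have hpar := excess_emod_two σ
  have hlast := h.last_lt_iff (by have := h.zero; have := h.two_pos; omega)
  have hx := h.last_x
  have hy := h.last_y
  have h0 := h.zero
  have h1 := h.one
  have hpos := h.two_pos
  rw [hn] at hlast hx hy hpar
  obtain ⟨b, f, hb, hf, hf0, hfb, hfab⟩ : ∃ (b : ℤ) (f : ℤ → ℤ),
      b = (if excess (σ ++ [t]) % 4 = 0 then -a else -a - 1) ∧ (∀ x y, f x < f y ↔ x < y) ∧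
      (∀ x, 0 ≤ x → f x = x) ∧ (∀ x, f x ≠ b) ∧
      f (-a) = (if excess (σ ++ [t]) % 4 = 0 then b - 1 else b + 1) := by
    split_ifs with h4
    · exact ⟨_, fun x => if x ≤ -a then x - 1 else x, rfl,
        fun x y => by simp only; split_ifs <;> omega,
        fun x hx => if_neg (by omega), fun x => by simp only; split_ifs <;> omega, if_pos le_rfl⟩
    · exact ⟨_, fun x => if x < -a then x - 1 else x, rfl,
        fun x y => by simp only; split_ifs <;> omega,
        fun x hx => if_neg (by omega), fun x => by simp only; split_ifs <;> omega,
        by simp⟩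
  rw [← hb]
  let d : ℕ → ℤ := fun i => if i = n + 3 then b else if i % 2 = 0 then f (c i) else c i
  have hd0 : ∀ i ≤ n + 2, i % 2 = 0 → d i = f (c i) := fun i hi hp => by
    simp only [d]; rw [if_neg (by omega), if_pos hp]
  have hd1 : ∀ i ≤ n + 2, i % 2 = 1 → d i = c i := fun i hi hp => by
    simp only [d]; rw [if_neg (by omega), if_neg (by omega)]
  have hd3 : d (n + 3) = b := if_pos rfl
  have hr : IsRealization d σ := by
    refine (h.of_lt_iff_lt (d := fun i => if i % 2 = 0 then f (c i) else c i)
      fun i j hij => ?_).congr fun i hi => if_neg (by omega)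
    simp only [hij]
    split_ifs
    · exact hf _ _
    · rfl
  have e0 := hd1 n (by omega) (by omega)
  have e1 := hd0 (n + 1) (by omega) (by omega)
  have e2 := hd1 (n + 2) le_rfl (by omega)
  rw [hx, hfab] at e1
  have hr' : IsRealization d (σ ++ [t]) := by
    refine hr.attach hn ?_ ?_ fun j hj hp => ?_
    · unfold TurnOK
      rw [e0, e1, e2, hd3]
      cases t
      · rw [excess_concat_L]
        simp only [Turn.toNat]
        split_ifs <;> omega
      · rw [excess_concat_R]
        simp only [Turn.toNat]
        split_ifs <;> omega
    · rw [e1, hd3]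
      split_ifs <;> omega
    · rw [hd0 j hj (by omega), hd3]
      exact hfb _
  obtain ⟨C, hC⟩ := hr'.exists_chain
    (by rw [hd0 0 (by omega) rfl, h0, hf0 0 le_rfl])
    (by rw [hd1 1 (by omega) rfl, h1])
    (by rw [hd0 2 (by omega) rfl, hf0 _ hpos.le]; exact hpos)
  refine ⟨C, ?_⟩
  rw [hC, List.length_append, List.length_singleton, hn, alternatingPts, if_neg (by omega)]
  simp only [add_assoc, Nat.reduceAdd]
  rw [hd3, e2, hy]

/-- **Upper bound on the closest reachable point on the `-x`-axis for large excess.**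
For `l - r ≥ 3`: if `l - r ≡ 2 (mod 4)` and the last turn is `R`, some chain realizing
`σ` ends at `(-a, 0)` with `1 ≤ a ≤ ⌊(l - r + 2)/4⌋ + 1`; otherwise some chain realizing
`σ` ends at `(-a, 0)` with `1 ≤ a ≤ ⌊(l - r + 2)/4⌋`. -/
theorem upper_bound_x_minus_large (σ : List Turn) (h3 : 3 ≤ excess σ) :
    (excess σ % 4 = 2 ∧ σ.getLast? = some Turn.R →
      ∃ (C : Chain σ) (a : ℤ), 1 ≤ a ∧ a ≤ (excess σ + 2) / 4 + 1 ∧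
        C.pts (σ.length + 1) = (-a, 0)) ∧
    (¬(excess σ % 4 = 2 ∧ σ.getLast? = some Turn.R) →
      ∃ (C : Chain σ) (a : ℤ), 1 ≤ a ∧ a ≤ (excess σ + 2) / 4 ∧
        C.pts (σ.length + 1) = (-a, 0)) := by
  have hpar := excess_emod_two σ
  rcases Int.emod_two_eq_zero_or_one (excess σ) with he | he
  · rcases List.eq_nil_or_concat' σ with rfl | ⟨ρ, t, rfl⟩
    · simp [excess] at h3
    have hρ : excess (ρ ++ [t]) = excess ρ + 1 ∧ t = Turn.L ∨
        excess (ρ ++ [t]) = excess ρ - 1 ∧ t = Turn.R := by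
      cases t
      · exact Or.inl ⟨excess_concat_L ρ, rfl⟩
      · exact Or.inr ⟨excess_concat_R ρ, rfl⟩
    obtain ⟨c, hc⟩ := exists_isFlexible ρ (by omega) (by omega)
    obtain ⟨C, hC⟩ := hc.exists_chain_concat (by omega) (by omega) t
    rw [List.getLast?_concat, Option.some_inj]
    refine ⟨fun h => ⟨C, (excess ρ + 2) / 4 + 1, by omega, ?_, ?_⟩, fun h => ?_⟩
    · omega
    · rw [hC, if_neg (by omega), neg_add']
    · by_cases h4 : excess (ρ ++ [t]) % 4 = 0
      · refine ⟨C, (excess ρ + 2) / 4, by omega, by omega, ?_⟩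
        rw [hC, if_pos h4]
      · refine ⟨C, (excess ρ + 2) / 4 + 1, by omega, ?_, ?_⟩
        · have ht : t ≠ Turn.R := fun ht => h ⟨by omega, ht⟩
          have := hρ.resolve_right fun h' => ht h'.2
          omega
        · rw [hC, if_neg h4, neg_add']
  · obtain ⟨c, hc⟩ := exists_isFlexible σ h3 he
    obtain ⟨C, hC⟩ := hc.exists_chain hc.zero hc.one hc.two_pos
    refine ⟨fun h => by omega, fun _ => ⟨C, (excess σ + 2) / 4, by omega, le_rfl, ?_⟩⟩
    rw [hC, alternatingPts, if_pos (by omega), hc.last_x, hc.last_y]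
end

section
/- Minimum number of vertical segments crossing the segment from the origin to the endpoint: Let σ be a turn sequence with l L's and r R's, l − r ≥ 0 and l − r ≢ 0 (mod 4), and let C be any rectilinear chain realizing σ whose endpoint is p = (a, 0) with a > 0. If σ₁ = L, then at least |⌊(l − r)/4⌋ − 1| + 1 vertical segments of C intersect the closed segment from o = (0,0) to p; if σ₁ = R, then at least ⌊(l − r)/4⌋ + 1 vertical segments of C intersect this segment. -/
namespace RectChain

/-- Two axis-parallel segments (given by their endpoints) are disjoint. -/
def Sep (a b c d : ℤ × ℤ) : Prop :=
  max a.1 b.1 < min c.1 d.1 ∨ max c.1 d.1 < min a.1 b.1 ∨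
  max a.2 b.2 < min c.2 d.2 ∨ max c.2 d.2 < min a.2 b.2

/-- The segment from `a` to `b` is vertical and nondegenerate. -/
def Vert (a b : ℤ × ℤ) : Prop := a.1 = b.1 ∧ a.2 ≠ b.2

/-- The segment from `a` to `b` is horizontal and nondegenerate. -/
def Horiz (a b : ℤ × ℤ) : Prop := a.2 = b.2 ∧ a.1 ≠ b.1

/-- The path `a`, `b`, `c` makes a right angle at `b`. -/
def Corner (a b c : ℤ × ℤ) : Prop := (Vert a b ∧ Horiz b c) ∨ (Horiz a b ∧ Vert b c)

/-- The signed quarter turn made at `b` by the path `a`, `b`, `c`: `1` for a left turn,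
`-1` for a right turn. -/
def turn (a b c : ℤ × ℤ) : ℤ :=
  (b.1 - a.1).sign * (c.2 - b.2).sign - (b.2 - a.2).sign * (c.1 - b.1).sign

/-- The indicator of positivity. -/
def pos (x : ℤ) : ℤ := if 0 < x then 1 else 0

/-- The signed number of crossings of an axis-parallel move from `u` to `v` with (a
perturbation of) the positive horizontal axis. -/
def rayCross (u v : ℤ × ℤ) : ℤ := pos u.1 * (pos v.2 - pos u.2)

/-- The direction of an axis-parallel segment, numbered counterclockwise from north. -/
def dirIndex (a b : ℤ × ℤ) : ℤ :=
  if a.2 < b.2 then 0 else if b.1 < a.1 then 1 else if b.2 < a.2 then 2 else 3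

lemma sign_cases (x : ℤ) (hx : x ≠ 0) : (0 < x ∧ x.sign = 1) ∨ (x < 0 ∧ x.sign = -1) := by
  rcases lt_or_gt_of_ne hx with h | h
  · exact Or.inr ⟨h, Int.sign_eq_neg_one_of_neg h⟩
  · exact Or.inl ⟨h, Int.sign_eq_one_of_pos h⟩

lemma turn_eq {a b c : ℤ × ℤ} (h : Corner a b c) :
    turn a b c = dirIndex b c - dirIndex a b +
      4 * (rayCross (b - a) (c - a) + rayCross (c - a) (c - b)) := by
  obtain ⟨a1, a2⟩ := a
  obtain ⟨b1, b2⟩ := b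
  obtain ⟨c1, c2⟩ := c
  simp only [Corner, Vert, Horiz, turn, dirIndex, rayCross, pos, Prod.fst_sub, Prod.snd_sub] at *
  rcases h with ⟨⟨rfl, h1⟩, rfl, h2⟩ | ⟨⟨rfl, h1⟩, rfl, h2⟩
  · rcases sign_cases (b2 - a2) (by omega) with ⟨h3, e3⟩ | ⟨h3, e3⟩ <;>
    rcases sign_cases (c1 - a1) (by omega) with ⟨h4, e4⟩ | ⟨h4, e4⟩ <;>
    rw [e3, e4] <;> simp only [sub_self, Int.sign_zero, mul_zero] <;> split_ifs <;> omega
  · rcases sign_cases (b1 - a1) (by omega) with ⟨h3, e3⟩ | ⟨h3, e3⟩ <;>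
    rcases sign_cases (c2 - a2) (by omega) with ⟨h4, e4⟩ | ⟨h4, e4⟩ <;>
    rw [e3, e4] <;> simp only [sub_self, Int.sign_zero, mul_zero] <;> split_ifs <;> omega

/-- The crossing number with the ray is a closed discrete form away from the origin. -/
lemma rayCross_cell {a b c d : ℤ × ℤ} (h : Sep a b c d) (hab : Vert a b ∨ Horiz a b)
    (hcd : Vert c d ∨ Horiz c d) :
    rayCross (c - a) (d - a) + rayCross (d - a) (d - b) =
      rayCross (c - a) (c - b) + rayCross (c - b) (d - b) := by
  obtain ⟨a1, a2⟩ := a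
  obtain ⟨b1, b2⟩ := b
  obtain ⟨c1, c2⟩ := c
  obtain ⟨d1, d2⟩ := d
  simp only [Sep, Vert, Horiz, rayCross, pos, Prod.fst_sub, Prod.snd_sub] at *
  rcases hab with ⟨rfl, h1⟩ | ⟨rfl, h1⟩ <;> rcases hcd with ⟨rfl, h2⟩ | ⟨rfl, h2⟩
  · ring
  · ring_nf
    split_ifs <;> omega
  · split_ifs <;> omega
  · ring

lemma Sep.symm {a b c d : ℤ × ℤ} (h : Sep a b c d) : Sep c d a b := by
  simp only [Sep] at *
  omega

lemma sum_column (α β : ℕ → ℕ → ℤ) (m j : ℕ)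
    (cell : ∀ i < m, α i j + β i (j + 1) = β i j + α (i + 1) j) :
    ∑ i ∈ Finset.range m, β i j + α m j = α 0 j + ∑ i ∈ Finset.range m, β i (j + 1) := by
  induction m with
  | zero => simp
  | succ m ih =>
    rw [Finset.sum_range_succ, Finset.sum_range_succ]
    linarith [ih fun i hi => cell i (by omega), cell m (by omega)]

lemma sum_diagonal (α β : ℕ → ℕ → ℤ) (n : ℕ)
    (cell : ∀ i j, i + 2 ≤ j → j ≤ n → α i j + β i (j + 1) = β i j + α (i + 1) j) :
    ∑ i ∈ Finset.range n, (α i (i + 1) + β i (i + 2)) =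
      ∑ j ∈ Finset.range n, α 0 (j + 1) + ∑ i ∈ Finset.range n, β i (n + 1) := by
  induction n with
  | zero => simp
  | succ n ih =>
    rw [Finset.sum_range_succ, ih fun i j h1 h2 => cell i j h1 (by omega),
      Finset.sum_range_succ (fun j => α 0 (j + 1)),
      Finset.sum_range_succ (fun i => β i (n + 1 + 1))]
    linarith [sum_column α β n (n + 1) fun i hi => cell i (n + 1) (by omega) le_rfl]

/-- A closed rectilinear polygon with `M` vertices, given as an `M`-periodic sequence, is
simple. -/
structure SimplePolygon (w : ℕ → ℤ × ℤ) (M : ℕ) : Prop where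
  periodic : ∀ n, w (n + M) = w n
  corner : ∀ n, Corner (w n) (w (n + 1)) (w (n + 2))
  sep : ∀ i j, i + 2 ≤ j → j + 2 ≤ i + M → Sep (w i) (w (i + 1)) (w j) (w (j + 1))


lemma rayCross_upper {a b c : ℤ × ℤ} (hbc : Vert b c ∨ Horiz b c)
    (hb : a.2 < b.2 ∨ a.2 = b.2 ∧ a.1 < b.1) (hc : a.2 < c.2 ∨ a.2 = c.2 ∧ a.1 < c.1) :
    rayCross (b - a) (c - a) = pos (c.2 - a.2) - pos (b.2 - a.2) := by
  obtain ⟨a1, a2⟩ := a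
  obtain ⟨b1, b2⟩ := b
  obtain ⟨c1, c2⟩ := c
  simp only [Vert, Horiz, rayCross, pos, Prod.fst_sub, Prod.snd_sub] at *
  rcases hbc with ⟨rfl, h2⟩ | ⟨rfl, h2⟩ <;> split_ifs <;> omega

lemma rayCross_lower {a b c : ℤ × ℤ} (hb : a.2 ≤ b.2) (hc : a.2 ≤ c.2) :
    rayCross (a - b) (a - c) = 0 := by
  simp only [rayCross, pos, Prod.fst_sub, Prod.snd_sub]
  split_ifs <;> omega

lemma corner_axis {a b c : ℤ × ℤ} (h : Corner a b c) : Vert a b ∨ Horiz a b :=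
  h.imp And.left And.left

lemma SimplePolygon.cell {w : ℕ → ℤ × ℤ} {M : ℕ} (hw : SimplePolygon w M) (i j : ℕ)
    (h1 : i + 2 ≤ j) (h2 : j + 2 ≤ i + M) :
    rayCross (w j - w i) (w (j + 1) - w i) + rayCross (w (j + 1) - w i) (w (j + 1) - w (i + 1)) =
      rayCross (w j - w i) (w j - w (i + 1)) +
        rayCross (w j - w (i + 1)) (w (j + 1) - w (i + 1)) :=
  rayCross_cell (hw.sep i j h1 h2) (corner_axis (hw.corner i)) (corner_axis (hw.corner j))

lemma SimplePolygon.ne_start {w : ℕ → ℤ × ℤ} {M : ℕ} (hw : SimplePolygon w M) {j : ℕ}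
    (h1 : 1 ≤ j) (h2 : j < M) : w j ≠ w 0 := by
  intro h
  have hM := hw.periodic 0
  rcases Nat.lt_or_ge j 2 with h3 | h3
  · obtain rfl : j = 1 := by omega
    have := corner_axis (hw.corner 0)
    simp only [Vert, Horiz, zero_add, h] at this
    omega
  · rcases Nat.lt_or_ge (j + 1) M with h4 | h4
    · have := hw.sep 0 j (by omega) (by omega)
      simp only [Sep, zero_add, h] at this
      omega
    · have := corner_axis (hw.corner j)
      rw [show j + 1 = 0 + M by omega, hM] at this
      simp only [Vert, Horiz, h] at this
      omega

/-- **Umlaufsatz**, for a polygon starting at its lexicographically lowest vertex. -/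
lemma SimplePolygon.sum_turn_of_lowest {w : ℕ → ℤ × ℤ} {M : ℕ} (hw : SimplePolygon w M)
    (hM : 4 ≤ M) (low : ∀ j, (w 0).2 < (w j).2 ∨ (w 0).2 = (w j).2 ∧ (w 0).1 ≤ (w j).1) :
    |∑ i ∈ Finset.range M, turn (w i) (w (i + 1)) (w (i + 2))| = 4 := by
  obtain ⟨m, rfl⟩ : ∃ m, M = m + 3 := ⟨M - 3, by omega⟩
  have upper : ∀ j, 1 ≤ j → j < m + 3 →
      (w 0).2 < (w j).2 ∨ (w 0).2 = (w j).2 ∧ (w 0).1 < (w j).1 := by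
    intro j h1 h2
    have h3 := hw.ne_start h1 h2
    rw [Ne, Prod.ext_iff] at h3
    have := low j
    omega
  have e0 : w (m + 3) = w 0 := by simpa using hw.periodic 0
  have e1 : w (m + 4) = w 1 := by simpa [add_comm, add_left_comm] using hw.periodic 1
  let α : ℕ → ℕ → ℤ := fun i j => rayCross (w j - w i) (w (j + 1) - w i)
  let β : ℕ → ℕ → ℤ := fun i j => rayCross (w j - w i) (w j - w (i + 1))
  have diag := sum_diagonal α β (m + 1) fun i j h1 h2 => hw.cell i j h1 (by omega)
  have col := sum_column (fun i j => α (i + 1) j) (fun i j => β (i + 1) j) m (m + 2)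
    fun i hi => hw.cell (i + 1) (m + 2) (by omega) (by omega)
  have row : ∑ j ∈ Finset.range (m + 1), α 0 (j + 1) =
      pos ((w (m + 2)).2 - (w 0).2) - pos ((w 1).2 - (w 0).2) := by
    rw [← Finset.sum_range_sub (fun j => pos ((w (j + 1)).2 - (w 0).2))]
    refine Finset.sum_congr rfl fun j hj => ?_
    rw [Finset.mem_range] at hj
    exact rayCross_upper (corner_axis (hw.corner (j + 1))) (upper _ (by omega) (by omega))
      (upper _ (by omega) (by omega))
  have last : ∀ i, β i (m + 3) = 0 := by
    intro i
    simp only [β, e0]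
    exact rayCross_lower (by have := low i; omega) (by have := low (i + 1); omega)
  have total : ∑ i ∈ Finset.range (m + 3), turn (w i) (w (i + 1)) (w (i + 2)) =
      dirIndex (w (m + 2)) (w 0) - dirIndex (w 0) (w 1)
        + 4 * ∑ i ∈ Finset.range (m + 2), (α i (i + 1) + β i (i + 2))
        + turn (w (m + 2)) (w 0) (w 1) := by
    have tele := Finset.sum_range_sub (fun i => dirIndex (w i) (w (i + 1))) (m + 2)
    rw [show m + 2 + 1 = m + 3 from rfl, e0] at tele
    rw [Finset.sum_range_succ, e0, e1, Finset.mul_sum, ← tele, ← Finset.sum_add_distrib]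
    congr 1
    exact Finset.sum_congr rfl fun i _ => turn_eq (hw.corner i)
  have diag_last := Finset.sum_range_succ (fun i => α i (i + 1) + β i (i + 2)) (m + 1)
  have col_first := Finset.sum_range_succ' (fun i => β i (m + 1 + 1)) m
  simp only [last, Finset.sum_const_zero, zero_add, add_zero] at col
  have hu := upper 1 le_rfl (by omega)
  have hv := upper (m + 2) (by omega) (by omega)
  have corner := hw.corner (m + 2)
  rw [e0, e1] at corner
  have total' : ∑ i ∈ Finset.range (m + 3), turn (w i) (w (i + 1)) (w (i + 2)) =
      dirIndex (w (m + 2)) (w 0) - dirIndex (w 0) (w 1)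
        + 4 * (pos ((w (m + 2)).2 - (w 0).2) - pos ((w 1).2 - (w 0).2)
          + rayCross (w (m + 2) - w 0) (w (m + 2) - w 1)
          + rayCross (w (m + 2) - w 1) (w 0 - w 1))
        + turn (w (m + 2)) (w 0) (w 1) := by
    have hb : β 0 (m + 1 + 1) = rayCross (w (m + 2) - w 0) (w (m + 2) - w 1) := rfl
    have ha : α 1 (m + 2) = rayCross (w (m + 2) - w 1) (w 0 - w 1) := by
      simp only [α, ← e0]
    have hl : β (m + 1) (m + 1 + 2) = 0 := last _
    rw [total, ← hb, ← ha]
    linarith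
  rw [total']
  clear total' total diag col row last upper low
  generalize w (m + 2) = v at *
  generalize w 0 = o at *
  generalize w 1 = u at *
  obtain ⟨v1, v2⟩ := v
  obtain ⟨o1, o2⟩ := o
  obtain ⟨u1, u2⟩ := u
  simp only [Corner, Vert, Horiz, turn, dirIndex, rayCross, pos, Prod.fst_sub, Prod.snd_sub] at *
  rcases corner with ⟨⟨rfl, h1⟩, rfl, h2⟩ | ⟨⟨rfl, h1⟩, rfl, h2⟩
  · rw [Int.sign_eq_neg_one_of_neg (show o2 - v2 < 0 by omega),
      Int.sign_eq_one_of_pos (show 0 < u1 - v1 by omega)]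
    split_ifs <;> first | omega | simp
  · rw [Int.sign_eq_neg_one_of_neg (show o1 - v1 < 0 by omega),
      Int.sign_eq_one_of_pos (show 0 < u2 - v2 by omega)]
    split_ifs <;> first | omega | simp

lemma sum_range_shift (f : ℕ → ℤ) (M b : ℕ) (hf : ∀ n, f (n + M) = f n) :
    ∑ i ∈ Finset.range M, f (b + i) = ∑ i ∈ Finset.range M, f i := by
  induction b with
  | zero => simp
  | succ b ih =>
    have h1 := Finset.sum_range_succ (fun i => f (b + i)) M
    have h2 := Finset.sum_range_succ' (fun i => f (b + i)) M
    rw [hf, h2] at h1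
    rw [← ih, ← add_left_injective (f (b + 0)) |>.eq_iff]
    simpa [add_comm, add_left_comm] using h1

/-- **Umlaufsatz** for simple rectilinear polygons. -/
theorem SimplePolygon.sum_turn {w : ℕ → ℤ × ℤ} {M : ℕ} (hw : SimplePolygon w M) (hM : 4 ≤ M) :
    |∑ i ∈ Finset.range M, turn (w i) (w (i + 1)) (w (i + 2))| = 4 := by
  obtain ⟨b, -, hb⟩ := Finset.exists_min_image (Finset.range M)
    (fun i => toLex ((w i).2, (w i).1)) ⟨0, Finset.mem_range.2 (by omega)⟩
  have hper : ∀ n, w (n % M) = w n := Function.Periodic.map_mod_nat hw.periodic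
  rw [← sum_range_shift (fun i => turn (w i) (w (i + 1)) (w (i + 2))) M b]
  · refine SimplePolygon.sum_turn_of_lowest (w := fun i => w (b + i)) ⟨?_, ?_, ?_⟩ hM ?_
    · intro n
      rw [← add_assoc, hw.periodic]
    · exact fun n => hw.corner (b + n)
    · exact fun i j h1 h2 => hw.sep (b + i) (b + j) (by omega) (by omega)
    · intro j
      have := hb ((b + j) % M) (Finset.mem_range.2 (Nat.mod_lt _ (by omega)))
      rw [hper, Prod.Lex.le_iff] at this
      simpa using this
  · intro n
    simp only [add_right_comm n M, hw.periodic]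

lemma SimplePolygon.of_cycle {u : ℕ → ℤ × ℤ} {d : ℕ} (hd : 2 ≤ d)
    (corner : ∀ k, k < d → Corner (u k) (u (k + 1)) (u (k + 2)))
    (corner₁ : Corner (u d) (u (d + 1)) (u 0)) (corner₂ : Corner (u (d + 1)) (u 0) (u 1))
    (sep : ∀ i j, i + 2 ≤ j → j ≤ d → Sep (u i) (u (i + 1)) (u j) (u (j + 1)))
    (sep_last : ∀ i, 1 ≤ i → i < d → Sep (u i) (u (i + 1)) (u (d + 1)) (u 0)) :
    SimplePolygon (fun n => u (n % (d + 2))) (d + 2) := by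
  have hlt : ∀ n, n < d + 2 → n % (d + 2) = n := fun n => Nat.mod_eq_of_lt
  have hs : ∀ i j, i + 2 ≤ j → j < d + 2 → j + 2 ≤ i + (d + 2) →
      Sep (u (i % (d + 2))) (u ((i + 1) % (d + 2))) (u (j % (d + 2))) (u ((j + 1) % (d + 2))) := by
    intro i j h1 h2 h3
    rw [hlt i (by omega), hlt (i + 1) (by omega), hlt j h2]
    rcases Nat.lt_or_ge d j with h4 | h4
    · obtain rfl : j = d + 1 := by omega
      rw [Nat.mod_self]
      exact sep_last i (by omega) (by omega)
    · rw [hlt (j + 1) (by omega)]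
      exact sep i j h1 h4
  have red : ∀ n c, (n + c) % (d + 2) = (n % (d + 2) + c) % (d + 2) := by simp
  refine ⟨fun n => by simp, fun n => ?_, fun i j h1 h2 => ?_⟩
  · simp only [red n 1, red n 2]
    have hn := Nat.mod_lt n (show 0 < d + 2 by omega)
    generalize n % (d + 2) = k at *
    rcases Nat.lt_or_ge k d with h | h
    · rw [hlt (k + 1) (by omega), hlt (k + 2) (by omega)]
      exact corner k h
    · obtain rfl | rfl : k = d ∨ k = d + 1 := by omega
      · rw [hlt (k + 1) (by omega), Nat.mod_self]
        exact corner₁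
      · rw [Nat.mod_self, show d + 1 + 2 = 1 + (d + 2) by omega, Nat.add_mod_right,
          hlt 1 (by omega)]
        exact corner₂
  · obtain ⟨r, t, rfl, hr⟩ : ∃ r t, i = r + (d + 2) * t ∧ r < d + 2 :=
      ⟨_, _, (Nat.mod_add_div i (d + 2)).symm, Nat.mod_lt _ (by omega)⟩
    obtain ⟨s, rfl⟩ : ∃ s, j = s + (d + 2) * t := ⟨j - (d + 2) * t, by omega⟩
    rw [add_right_comm r, add_right_comm s]
    simp only [Nat.add_mul_mod_self_left]
    rcases Nat.lt_or_ge s (d + 2) with h | h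
    · exact hs r s (by omega) h (by omega)
    · obtain ⟨q, rfl⟩ : ∃ q, s = q + (d + 2) := ⟨s - (d + 2), by omega⟩
      have := hs q r (by omega) hr (by omega)
      rw [add_right_comm q, Nat.add_mod_right, Nat.add_mod_right]
      exact this.symm

/-- The points `Q 0, …, Q m` form a simple rectilinear chain. -/
structure SimplePath (Q : ℕ → ℤ × ℤ) (m : ℕ) : Prop where
  corner : ∀ i, i + 2 ≤ m → Corner (Q i) (Q (i + 1)) (Q (i + 2))
  sep : ∀ i j, i + 2 ≤ j → j + 1 ≤ m → Sep (Q i) (Q (i + 1)) (Q j) (Q (j + 1))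

/-- The segment from `Q i` to `Q (i + 1)` is vertical and properly crosses height `h`. -/
def Crosses (Q : ℕ → ℤ × ℤ) (h : ℤ) (i : ℕ) : Prop :=
  (Q i).1 = (Q (i + 1)).1 ∧
    ((Q i).2 < h ∧ h < (Q (i + 1)).2 ∨ (Q (i + 1)).2 < h ∧ h < (Q i).2)

/-- The total turning of the closed path that follows `Q` from its vertical segment `i` to its
vertical segment `j`, and returns along a horizontal segment. -/
def closedTurning (Q : ℕ → ℤ × ℤ) (i j : ℕ) : ℤ :=
  ∑ l ∈ Finset.Ico i j, turn (Q l) (Q (l + 1)) (Q (l + 2)) +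
    ((Q i).1 - (Q j).1).sign *
      (((Q (i + 1)).2 - (Q i).2).sign - ((Q (j + 1)).2 - (Q j).2).sign)

section Crossings

variable {Q : ℕ → ℤ × ℤ} {m : ℕ} {h : ℤ}

lemma Crosses.add_two_le (hQ : SimplePath Q m) {i j : ℕ} (hi : Crosses Q h i)
    (hj : Crosses Q h j) (hij : i < j) (hjm : j + 1 ≤ m) : i + 2 ≤ j := by
  by_contra hlt
  obtain rfl : j = i + 1 := by omega
  have h1 := hQ.corner i (by omega)
  have h2 : (Q (i + 1)).1 = (Q (i + 2)).1 := hj.1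
  have h3 := hi.1
  simp only [Corner, Vert, Horiz] at h1
  omega

lemma Crosses.fst_ne (hQ : SimplePath Q m) {i j : ℕ} (hi : Crosses Q h i)
    (hj : Crosses Q h j) (hij : i < j) (hjm : j + 1 ≤ m) : (Q i).1 ≠ (Q j).1 := by
  have := hQ.sep i j (hi.add_two_le hQ hj hij hjm) hjm
  simp only [Sep, Crosses] at *
  omega

lemma Crosses.sign_eq {j : ℕ} (hj : Crosses Q h j) :
    (h - (Q j).2).sign = ((Q (j + 1)).2 - (Q j).2).sign ∧
      ((Q (j + 1)).2 - h).sign = ((Q (j + 1)).2 - (Q j).2).sign := by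
  rcases hj.2 with hh | hh
  · simp only [Int.sign_eq_one_of_pos (show 0 < h - (Q j).2 by omega),
      Int.sign_eq_one_of_pos (show 0 < (Q (j + 1)).2 - (Q j).2 by omega),
      Int.sign_eq_one_of_pos (show 0 < (Q (j + 1)).2 - h by omega), and_self]
  · simp only [Int.sign_eq_neg_one_of_neg (show h - (Q j).2 < 0 by omega),
      Int.sign_eq_neg_one_of_neg (show (Q (j + 1)).2 - (Q j).2 < 0 by omega),
      Int.sign_eq_neg_one_of_neg (show (Q (j + 1)).2 - h < 0 by omega), and_self]

/-- The closed polygon made of the part of `Q` between two crossings of height `h` and the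
horizontal segment at that height is simple if no intermediate crossing lies between the two,
so its total turning is a full turn. -/
lemma abs_closedTurning (hQ : SimplePath Q m) (gen : ∀ l ≤ m, (Q l).2 ≠ h) {i j : ℕ}
    (hi : Crosses Q h i) (hj : Crosses Q h j) (hij : i < j) (hjm : j + 1 ≤ m)
    (hno : ∀ k, i < k → k < j → Crosses Q h k →
      ¬ (min (Q i).1 (Q j).1 < (Q k).1 ∧ (Q k).1 < max (Q i).1 (Q j).1)) :
    |closedTurning Q i j| = 4 := by
  have hd := hi.add_two_le hQ hj hij hjm
  have hne := hi.fst_ne hQ hj hij hjm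
  obtain ⟨d, rfl⟩ : ∃ d, j = i + d := ⟨j - i, by omega⟩
  let u : ℕ → ℤ × ℤ := fun k =>
    if k = 0 then ((Q i).1, h) else if k ≤ d then Q (i + k) else ((Q (i + d)).1, h)
  have u0 : u 0 = ((Q i).1, h) := rfl
  have umid : ∀ k, 1 ≤ k → k ≤ d → u k = Q (i + k) := by
    intro k h1 h2
    simp only [u, if_neg (show k ≠ 0 by omega), if_pos h2]
  have ulast : u (d + 1) = ((Q (i + d)).1, h) := by
    simp [u]
  have edge : ∀ k, k ≤ d →
      (Vert (Q (i + k)) (Q (i + k + 1)) → Vert (u k) (u (k + 1))) ∧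
      (Horiz (Q (i + k)) (Q (i + k + 1)) → Horiz (u k) (u (k + 1))) ∧
      ((u (k + 1)).1 - (u k).1).sign = ((Q (i + k + 1)).1 - (Q (i + k)).1).sign ∧
      ((u (k + 1)).2 - (u k).2).sign = ((Q (i + k + 1)).2 - (Q (i + k)).2).sign ∧
      min (Q (i + k)).1 (Q (i + k + 1)).1 ≤ min (u k).1 (u (k + 1)).1 ∧
      max (u k).1 (u (k + 1)).1 ≤ max (Q (i + k)).1 (Q (i + k + 1)).1 ∧
      min (Q (i + k)).2 (Q (i + k + 1)).2 ≤ min (u k).2 (u (k + 1)).2 ∧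
      max (u k).2 (u (k + 1)).2 ≤ max (Q (i + k)).2 (Q (i + k + 1)).2 := by
    intro k hk
    rcases Nat.eq_zero_or_pos k with rfl | h0
    · have h1 := umid (0 + 1) le_rfl (by omega)
      rw [zero_add] at h1
      have hs := hi.sign_eq.2
      simp only [u0, zero_add, h1, add_zero, hs, Crosses, Vert, Horiz] at hi ⊢
      refine ⟨?_, ?_, trivial, trivial, ?_, ?_, ?_, ?_⟩ <;> omega
    · rcases Nat.lt_or_ge k d with h1 | h1
      · rw [umid k h0 hk, umid (k + 1) (by omega) h1]
        simp [add_assoc]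
      · obtain rfl : k = d := by omega
        have hs := hj.sign_eq.1
        have hx := hj.1
        have hy := hj.2
        simp only [umid k h0 hk, ulast, hs, Vert, Horiz, true_and]
        refine ⟨?_, ?_, by rw [← hx], ?_, ?_, ?_, ?_⟩ <;> omega
  have hturn : ∀ k, k < d →
      turn (u k) (u (k + 1)) (u (k + 2)) = turn (Q (i + k)) (Q (i + k + 1)) (Q (i + k + 2)) := by
    intro k hk
    obtain ⟨-, -, e1, e2, -⟩ := edge k hk.le
    obtain ⟨-, -, e3, e4, -⟩ := edge (k + 1) hk
    simp only [← add_assoc] at e3 e4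
    simp only [turn, e1, e2, e3, e4, add_assoc, Nat.reduceAdd]
  have poly : SimplePolygon (fun n => u (n % (d + 2))) (d + 2) := by
    refine SimplePolygon.of_cycle (by omega) ?_ ?_ ?_ ?_ ?_
    · intro k hk
      have h1 := edge k hk.le
      have h2 := edge (k + 1) hk
      simp only [← add_assoc] at h2
      exact (hQ.corner (i + k) (by omega)).imp (fun H => ⟨h1.1 H.1, h2.2.1 H.2⟩)
        (fun H => ⟨h1.2.1 H.1, h2.1 H.2⟩)
    · have := gen (i + d) (by omega)
      rw [umid d (by omega) le_rfl, ulast, u0]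
      exact Or.inl ⟨⟨rfl, this⟩, rfl, hne.symm⟩
    · have := gen (i + 1) (by omega)
      rw [ulast, u0, umid 1 le_rfl (by omega)]
      exact Or.inr ⟨⟨rfl, hne.symm⟩, hi.1, this.symm⟩
    · intro k l h1 h2
      have h3 := edge k (by omega)
      have h4 := edge l h2
      have h5 := hQ.sep (i + k) (i + l) (by omega) (by omega)
      simp only [Sep] at h5 ⊢
      omega
    · intro k h1 h2
      rw [umid k h1 h2.le, umid (k + 1) (by omega) h2, ulast, u0, ← add_assoc]
      have g1 := gen (i + k) (by omega)
      have g2 := gen (i + k + 1) (by omega)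
      by_cases hc : Crosses Q h (i + k)
      · have n1 := hi.fst_ne hQ hc (by omega) (by omega)
        have n2 := hc.fst_ne hQ hj (by omega) (by omega)
        have n3 := hno (i + k) (by omega) (by omega) hc
        have n4 := hc.1
        simp only [Sep]
        omega
      · have := corner_axis (hQ.corner (i + k) (by omega))
        simp only [Crosses, Vert, Horiz] at this hc
        simp only [Sep]
        omega
  have := poly.sum_turn (by omega)
  rw [Finset.sum_range_succ, Finset.sum_range_succ] at this
  have hlt : ∀ n, n < d + 2 → n % (d + 2) = n := fun n => Nat.mod_eq_of_lt
  rw [hlt d (by omega), hlt (d + 1) (by omega), Nat.mod_self,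
    show d + 1 + 2 = 1 + (d + 2) by omega, Nat.add_mod_right, hlt 1 (by omega),
    ulast, umid d (by omega) le_rfl, u0, umid 1 le_rfl (by omega)] at this
  have hsum : ∑ x ∈ Finset.range d, turn (u (x % (d + 2))) (u ((x + 1) % (d + 2)))
      (u ((x + 2) % (d + 2))) =
      ∑ l ∈ Finset.Ico i (i + d), turn (Q l) (Q (l + 1)) (Q (l + 2)) := by
    rw [Finset.sum_Ico_eq_sum_range, Nat.add_sub_cancel_left]
    refine Finset.sum_congr rfl fun k hk => ?_
    rw [Finset.mem_range] at hk
    rw [hlt k (by omega), hlt (k + 1) (by omega), hlt (k + 2) (by omega), hturn k hk]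
  rw [← this, closedTurning, hsum]
  congr 1
  simp only [turn, hj.sign_eq.1, hi.sign_eq.2, sub_self, Int.sign_zero]
  ring

/-- The turning between two crossings is bounded by four times the number of crossings. -/
lemma closedTurning_le (hQ : SimplePath Q m) (gen : ∀ l ≤ m, (Q l).2 ≠ h) {a : ℤ}
    {K : Finset ℕ} (hK : ∀ k < m, Crosses Q h k → 0 ≤ (Q k).1 → (Q k).1 ≤ a → k ∈ K)
    {i j : ℕ} (hi : Crosses Q h i) (hj : Crosses Q h j) (hij : i < j) (hjm : j + 1 ≤ m)
    (hi₀ : 0 ≤ (Q i).1) (hia : (Q i).1 ≤ a) (hj₀ : 0 ≤ (Q j).1) (hja : (Q j).1 ≤ a) :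
    closedTurning Q i j ≤ 4 * ∑ l ∈ Finset.Ico i j, if l ∈ K then 1 else 0 := by
  induction hd : j - i using Nat.strong_induction_on generalizing i j with
  | _ d ih =>
  by_cases hno : ∀ k, i < k → k < j → Crosses Q h k →
      ¬ (min (Q i).1 (Q j).1 < (Q k).1 ∧ (Q k).1 < max (Q i).1 (Q j).1)
  · have h1 := abs_closedTurning hQ gen hi hj hij hjm hno
    have h2 : (1 : ℤ) ≤ ∑ l ∈ Finset.Ico i j, if l ∈ K then 1 else 0 := by
      rw [Finset.sum_eq_sum_Ico_succ_bot hij, if_pos (hK i (by omega) hi hi₀ hia)]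
      have : (0 : ℤ) ≤ ∑ l ∈ Finset.Ico (i + 1) j, if l ∈ K then 1 else 0 :=
        Finset.sum_nonneg fun l _ => by split_ifs <;> simp
      omega
    have := le_abs_self (closedTurning Q i j)
    omega
  · push Not at hno
    obtain ⟨k, hik, hkj, hk, h1, h2⟩ := hno
    have hl := ih (k - i) (by omega) hi hk hik (by omega) hi₀ hia (by omega) (by omega) rfl
    have hr := ih (j - k) (by omega) hk hj hkj hjm (by omega) (by omega) hj₀ hja rfl
    rw [← Finset.sum_Ico_consecutive _ hik.le hkj.le]
    have hadd : closedTurning Q i j = closedTurning Q i k + closedTurning Q k j := by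
      simp only [closedTurning]
      rw [← Finset.sum_Ico_consecutive _ hik.le hkj.le]
      rcases lt_or_gt_of_ne (hi.fst_ne hQ hj hij hjm) with h3 | h3
      · rw [Int.sign_eq_neg_one_of_neg (show (Q i).1 - (Q j).1 < 0 by omega),
          Int.sign_eq_neg_one_of_neg (show (Q i).1 - (Q k).1 < 0 by omega),
          Int.sign_eq_neg_one_of_neg (show (Q k).1 - (Q j).1 < 0 by omega)]
        ring
      · rw [Int.sign_eq_one_of_pos (show 0 < (Q i).1 - (Q j).1 by omega),
          Int.sign_eq_one_of_pos (show 0 < (Q i).1 - (Q k).1 by omega),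
          Int.sign_eq_one_of_pos (show 0 < (Q k).1 - (Q j).1 by omega)]
        ring
    rw [hadd]
    linarith

end Crossings

lemma sep_of_segSet_inter {a b c d : ℤ × ℤ} (h : segSet a b ∩ segSet c d = ∅) : Sep a b c d := by
  by_contra hs
  have : (max (min a.1 b.1) (min c.1 d.1), max (min a.2 b.2) (min c.2 d.2)) ∈
      segSet a b ∩ segSet c d := by
    simp only [Sep, segSet, Set.mem_inter_iff, Set.mem_ofPred_eq] at hs ⊢
    omega
  rw [h] at this
  exact this

/-- The signed number of quarter turns of a turn. -/
def turnSign (t : Turn) : ℤ := if t = Turn.L then 1 else -1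

lemma excess_eq_sum (σ : List Turn) :
    excess σ = ∑ i ∈ Finset.range σ.length, turnSign (σ.getD i Turn.L) := by
  induction σ with
  | nil => rfl
  | cons t σ ih =>
    rw [List.length_cons, Finset.sum_range_succ']
    simp only [List.getD_cons_succ, List.getD_cons_zero, ← ih]
    cases t <;> simp [excess, turnSign] <;> ring

lemma corner_and_turn_of_unitDir {a b c : ℤ × ℤ} {t : Turn}
    (hab : (b.1 = a.1 ∧ b.2 ≠ a.2) ∨ (b.2 = a.2 ∧ b.1 ≠ a.1))
    (hbc : (c.1 = b.1 ∧ c.2 ≠ b.2) ∨ (c.2 = b.2 ∧ c.1 ≠ b.1))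
    (h : unitDir b c = (if t = Turn.L then rotCCW else rotCW) (unitDir a b)) :
    Corner a b c ∧ turn a b c = turnSign t := by
  have axis : ∀ {u v : ℤ × ℤ}, (v.1 = u.1 ∧ v.2 ≠ u.2) ∨ (v.2 = u.2 ∧ v.1 ≠ u.1) →
      (Vert u v ∧ (v.1 - u.1).sign = 0 ∧ ((v.2 - u.2).sign = 1 ∨ (v.2 - u.2).sign = -1)) ∨
      (Horiz u v ∧ (v.2 - u.2).sign = 0 ∧ ((v.1 - u.1).sign = 1 ∨ (v.1 - u.1).sign = -1)) := by
    rintro u v (⟨e, n⟩ | ⟨e, n⟩)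
    · exact Or.inl ⟨⟨e.symm, n.symm⟩, by simp [e],
        (sign_cases _ (sub_ne_zero.2 n)).imp And.right And.right⟩
    · exact Or.inr ⟨⟨e.symm, n.symm⟩, by simp [e],
        (sign_cases _ (sub_ne_zero.2 n)).imp And.right And.right⟩
  simp only [unitDir] at h
  rw [turn, turnSign]
  rcases axis hab with ⟨h1, e1, e2 | e2⟩ | ⟨h1, e1, e2 | e2⟩ <;>
  rcases axis hbc with ⟨h2, e3, e4 | e4⟩ | ⟨h2, e3, e4 | e4⟩ <;>
  rw [e1, e2, e3, e4] at h ⊢ <;>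
  cases t <;> simp [rotCCW, rotCW] at h <;>
  simp [Corner, h1, h2]

section

variable {σ : List Turn} (C : Chain σ)

lemma corner_and_turn {i : ℕ} (hi : i < σ.length) :
    Corner (C.pts i) (C.pts (i + 1)) (C.pts (i + 2)) ∧
      turn (C.pts i) (C.pts (i + 1)) (C.pts (i + 2)) = turnSign (σ.getD i Turn.L) := by
  rw [List.getD_eq_getElem _ _ hi]
  exact corner_and_turn_of_unitDir (C.axis_parallel i hi.le) (C.axis_parallel (i + 1) hi)
    (C.turns i hi)

lemma sum_turn_eq_excess :
    ∑ i ∈ Finset.range σ.length, turn (C.pts i) (C.pts (i + 1)) (C.pts (i + 2)) = excess σ := by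
  rw [excess_eq_sum]
  exact Finset.sum_congr rfl fun i hi => (corner_and_turn C (Finset.mem_range.1 hi)).2

/-- The excess number determines the direction of the last segment. -/
lemma excess_emod :
    excess σ % 4 = (dirIndex (C.pts σ.length) (C.pts (σ.length + 1)) + 1) % 4 := by
  have h1 := Finset.sum_range_sub (fun i => dirIndex (C.pts i) (C.pts (i + 1))) σ.length
  have h2 : dirIndex (C.pts 0) (C.pts (0 + 1)) = 3 := by
    obtain ⟨t, ht, h⟩ := C.first_seg
    rw [zero_add, h, C.start_eq]
    simp [dirIndex, ht.le]
  have h3 : excess σ = ∑ i ∈ Finset.range σ.length,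
      (dirIndex (C.pts (i + 1)) (C.pts (i + 1 + 1)) - dirIndex (C.pts i) (C.pts (i + 1))) +
      4 * ∑ i ∈ Finset.range σ.length,
        (rayCross (C.pts (i + 1) - C.pts i) (C.pts (i + 2) - C.pts i) +
          rayCross (C.pts (i + 2) - C.pts i) (C.pts (i + 2) - C.pts (i + 1))) := by
    rw [← sum_turn_eq_excess C, Finset.mul_sum, ← Finset.sum_add_distrib]
    exact Finset.sum_congr rfl fun i hi => turn_eq (corner_and_turn C (Finset.mem_range.1 hi)).1
  omega

/-- The endpoint of a chain lies on its last segment only. -/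
lemma endpoint_notMem {i : ℕ} (hi : i < σ.length) :
    C.pts (σ.length + 1) ∉ segSet (C.pts i) (C.pts (i + 1)) := by
  rw [segSet, Set.mem_ofPred_eq]
  rcases Nat.lt_or_ge (i + 1) σ.length with h | h
  · have := sep_of_segSet_inter (C.simple_nonadj i σ.length h le_rfl)
    simp only [Sep] at this
    omega
  · have := (corner_and_turn C hi).1
    rw [show σ.length = i + 1 by omega]
    simp only [Corner, Vert, Horiz, add_assoc, Nat.reduceAdd] at this ⊢
    omega

/-- The vertices of a chain, stretched vertically by a factor of four. -/
def stretch (k : ℕ) : ℤ × ℤ := ((C.pts k).1, 4 * (C.pts k).2)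

lemma simplePath_stretch : SimplePath (stretch C) (σ.length + 1) := by
  constructor
  · intro i hi
    have := (corner_and_turn C (show i < σ.length by omega)).1
    simp only [Corner, Vert, Horiz, stretch] at this ⊢
    omega
  · intro i j hij hj
    have := sep_of_segSet_inter (C.simple_nonadj i j hij (by omega))
    simp only [Sep, stretch] at this ⊢
    omega

lemma sign_four_mul_sub (x y : ℤ) : (4 * x - 4 * y).sign = (x - y).sign := by
  rw [← mul_sub, Int.sign_mul, show Int.sign 4 = 1 from rfl, one_mul]

lemma turn_stretch (i j k : ℕ) :
    turn (stretch C i) (stretch C j) (stretch C k) = turn (C.pts i) (C.pts j) (C.pts k) := by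
  simp only [turn, stretch, sign_four_mul_sub]

/-- The indices of the vertical segments of `C` meeting the segment from `(0, 0)` to `(a, 0)`. -/
def crossSet (a : ℤ) : Finset ℕ :=
  (Finset.range (σ.length + 1)).filter fun i =>
    (C.pts i).1 = (C.pts (i + 1)).1 ∧
    0 ≤ (C.pts i).1 ∧ (C.pts i).1 ≤ a ∧
    min (C.pts i).2 (C.pts (i + 1)).2 ≤ 0 ∧ 0 ≤ max (C.pts i).2 (C.pts (i + 1)).2

lemma mem_crossSet {a : ℤ} {i : ℕ} : i ∈ crossSet C a ↔ i < σ.length + 1 ∧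
    (C.pts i).1 = (C.pts (i + 1)).1 ∧
    0 ≤ (C.pts i).1 ∧ (C.pts i).1 ≤ a ∧
    min (C.pts i).2 (C.pts (i + 1)).2 ≤ 0 ∧ 0 ≤ max (C.pts i).2 (C.pts (i + 1)).2 := by
  rw [crossSet, Finset.mem_filter, Finset.mem_range]

lemma turnSign_cases (t : Turn) : turnSign t = 1 ∨ turnSign t = -1 := by
  cases t <;> simp [turnSign]

/-- The second segment is vertical, starts right of the origin, and heads in the direction
given by the first turn. -/
lemma second_segment (hn : 0 < σ.length) : (C.pts 1).2 = 0 ∧ 0 < (C.pts 1).1 ∧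
    (C.pts 2).1 = (C.pts 1).1 ∧ (C.pts 2).2.sign = turnSign (σ.getD 0 Turn.L) := by
  obtain ⟨t, ht, h1⟩ := C.first_seg
  obtain ⟨h2, h3⟩ := corner_and_turn C hn
  rw [zero_add, zero_add, C.start_eq, h1] at h2 h3
  simp only [Corner, Vert, Horiz, turn, sub_zero, sub_self, Int.sign_zero, zero_mul,
    Int.sign_eq_one_of_pos ht, one_mul] at h2 h3
  rw [h1]
  exact ⟨rfl, ht, by omega, h3⟩

/-- The endpoint of a chain on the positive horizontal axis lies beyond the first segment. -/
lemma first_segment_lt (hn : 0 < σ.length) {a : ℤ} (ha : 0 < a)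
    (hend : C.pts (σ.length + 1) = (a, 0)) : (C.pts 1).1 < a := by
  have h1 := endpoint_notMem C hn
  have h2 := second_segment C hn
  rw [zero_add, hend, C.start_eq, segSet, Set.mem_ofPred_eq] at h1
  simp only at h1
  omega

lemma one_mem_crossSet (hn : 0 < σ.length) {a : ℤ} (ha : (C.pts 1).1 ≤ a) : 1 ∈ crossSet C a := by
  have h2 := second_segment C hn
  rw [mem_crossSet]
  simp only [Nat.reduceAdd]
  omega

lemma sum_turn_Ico (hn : 0 < σ.length) :
    ∑ l ∈ Finset.Ico 1 σ.length, turn (C.pts l) (C.pts (l + 1)) (C.pts (l + 2)) =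
      excess σ - turnSign (σ.getD 0 Turn.L) := by
  have h1 := sum_turn_eq_excess C
  rw [Finset.range_eq_Ico, Finset.sum_eq_sum_Ico_succ_bot hn] at h1
  have h2 := (corner_and_turn C hn).2
  rw [zero_add] at h1
  linarith

lemma sum_indicator_le {K L : Finset ℕ} {i j : ℕ}
    (h : ∀ l ∈ K, i ≤ l → l < j → l ∈ L) :
    ∑ l ∈ Finset.Ico i j, (if l ∈ K then (1 : ℤ) else 0) ≤ L.card := by
  rw [Finset.sum_boole]
  exact_mod_cast Finset.card_le_card fun l hl => by
    rw [Finset.mem_filter, Finset.mem_Ico] at hl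
    exact h l hl.2 hl.1.1 hl.1.2

/-- The crossing bound for a chain whose last segment is vertical. -/
lemma excess_le_of_vertical_end (hn : 0 < σ.length) {a : ℤ} (ha : 0 < a)
    (hend : C.pts (σ.length + 1) = (a, 0)) (hx : (C.pts σ.length).1 = a)
    (hy : (C.pts σ.length).2 ≠ 0) : 2 ≤ (crossSet C a).card ∧
    ∃ r : ℤ, (r = 1 ∧ excess σ % 4 = 1 ∨ r = -1 ∧ excess σ % 4 = 3) ∧
      excess σ + r ≤ 4 * ((crossSet C a).card - 1) + 2 * turnSign (σ.getD 0 Turn.L) := by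
  have hta := first_segment_lt C hn ha hend
  obtain ⟨s1, s2, s3, s4⟩ := second_segment C hn
  have hone := one_mem_crossSet C hn hta.le
  have hsum := sum_turn_Ico C hn
  have hs := turnSign_cases (σ.getD 0 Turn.L)
  set n := σ.length with hn_def
  set s := turnSign (σ.getD 0 Turn.L) with hs_def
  have hn2 : 2 ≤ n := by
    by_contra h
    rw [show n = 1 by omega] at hx
    omega
  have hlast : n ∈ crossSet C a := by
    rw [mem_crossSet, hend]
    simp only
    omega
  have herase : ((crossSet C a).erase n).card + 1 = (crossSet C a).card :=
    Finset.card_erase_add_one hlast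
  have hcard : 2 ≤ (crossSet C a).card :=
    Finset.one_lt_card.2 ⟨1, hone, n, hlast, by omega⟩
  refine ⟨hcard, (-(C.pts n).2).sign, ?_, ?_⟩
  · have h1 := excess_emod C
    rw [← hn_def, hend, dirIndex] at h1
    simp only at h1
    rcases sign_cases (-(C.pts n).2) (by omega) with ⟨h, e⟩ | ⟨h, e⟩ <;> rw [e] <;>
    split_ifs at h1 <;> omega
  · have hr := sign_cases (-(C.pts n).2) (by omega)
    set r := (-(C.pts n).2).sign with hr_def
    set Q := Function.update (stretch C) (n + 1) (a, 2 * r) with hQ_def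
    have hQ : ∀ i ≤ n, Q i = ((C.pts i).1, 4 * (C.pts i).2) := fun i hi =>
      Function.update_of_ne (by omega) _ _
    have hQn : Q (n + 1) = (a, 2 * r) := Function.update_self ..
    have hpath : SimplePath Q (n + 1) := by
      constructor
      · intro i hi
        rcases Nat.lt_or_ge (i + 1) n with h | h
        · rw [hQ i (by omega), hQ (i + 1) (by omega), hQ (i + 2) (by omega)]
          exact (simplePath_stretch C).corner i (by omega)
        · have h1 := (corner_and_turn C (show i < n by omega)).1
          rw [show i + 1 = n by omega, show i + 2 = n + 1 by omega] at h1 ⊢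
          rw [hQ i (by omega), hQ n le_rfl, hQn]
          rw [hend] at h1
          simp only [Corner, Vert, Horiz] at h1 ⊢
          omega
      · intro i j hij hj
        rcases Nat.lt_or_ge j n with h | h
        · rw [hQ i (by omega), hQ (i + 1) (by omega), hQ j (by omega), hQ (j + 1) (by omega)]
          exact (simplePath_stretch C).sep i j (by omega) (by omega)
        · obtain rfl : j = n := by omega
          have h1 := sep_of_segSet_inter (C.simple_nonadj i n (by omega) le_rfl)
          rw [hQ i (by omega), hQ (i + 1) (by omega), hQ n (by omega), hQn]
          rw [hend] at h1
          simp only [Sep] at h1 ⊢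
          omega
    have gen : ∀ l ≤ n + 1, (Q l).2 ≠ s := by
      intro l hl
      rcases Nat.lt_or_ge n l with h | h
      · obtain rfl : l = n + 1 := by omega
        rw [hQn]
        simp only
        omega
      · rw [hQ l h]
        simp only
        omega
    have hs2 : (0 < (C.pts 2).2 ∧ s = 1) ∨ ((C.pts 2).2 < 0 ∧ s = -1) := by
      rw [← s4]
      exact sign_cases _ fun h => by rw [h, Int.sign_zero] at s4; omega
    have hc1 : Crosses Q s 1 := by
      rw [Crosses, hQ 1 (by omega), hQ (1 + 1) (by omega)]
      simp only [Nat.reduceAdd]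
      omega
    have hcn : Crosses Q s n := by
      rw [Crosses, hQ n le_rfl, hQn]
      simp only
      omega
    have hK : ∀ k < n + 1, Crosses Q s k → 0 ≤ (Q k).1 → (Q k).1 ≤ a → k ∈ crossSet C a := by
      intro k hk hc h0 h1
      rcases Nat.lt_or_ge k n with h | h
      · rw [Crosses, hQ k (by omega), hQ (k + 1) (by omega)] at hc
        rw [hQ k (by omega)] at h0 h1
        simp only at hc h0 h1
        rw [mem_crossSet]
        omega
      · obtain rfl : k = n := by omega
        exact hlast
    have hmain := closedTurning_le hpath gen hK hc1 hcn (by omega) le_rfl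
      (by rw [hQ 1 (by omega)]; exact s2.le) (by rw [hQ 1 (by omega)]; exact hta.le)
      (by rw [hQ n le_rfl]; simp only; omega) (by rw [hQ n le_rfl]; exact hx.le)
    have hind := sum_indicator_le (K := crossSet C a) (L := (crossSet C a).erase n) (i := 1)
      (j := n) fun l hl _ hln => Finset.mem_erase.2 ⟨by omega, hl⟩
    have hturn : ∑ l ∈ Finset.Ico 1 n, turn (Q l) (Q (l + 1)) (Q (l + 2)) = excess σ - s := by
      rw [← hsum]
      refine Finset.sum_congr rfl fun l hl => ?_
      rw [Finset.mem_Ico] at hl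
      rcases Nat.lt_or_ge (l + 1) n with h | h
      · rw [hQ l (by omega), hQ (l + 1) (by omega), hQ (l + 2) (by omega)]
        exact turn_stretch C l (l + 1) (l + 2)
      · rw [show l + 1 = n by omega, show l + 2 = n + 1 by omega]
        rw [hQ l (by omega), hQ n le_rfl, hQn, hend]
        simp only [turn, sign_four_mul_sub, hx, sub_self, Int.sign_zero, mul_zero, sub_zero]
        rw [zero_sub, ← hr_def]
        congr 1
        rcases hr with ⟨h1, h2⟩ | ⟨h1, h2⟩ <;> rw [h2]
        · exact Int.sign_eq_one_of_pos (by omega)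
        · exact Int.sign_eq_neg_one_of_neg (by omega)
    have e1 : ((Q 1).1 - (Q n).1).sign = -1 := by
      rw [hQ 1 (by omega), hQ n le_rfl]
      exact Int.sign_eq_neg_one_of_neg (by simp only; omega)
    have e2 : ((Q (1 + 1)).2 - (Q 1).2).sign = s := by
      rw [hQ 1 (by omega), hQ (1 + 1) (by omega)]
      simp only [sign_four_mul_sub, s1, sub_zero, Nat.reduceAdd, s4]
    have e3 : ((Q (n + 1)).2 - (Q n).2).sign = r := by
      rw [hQn, hQ n le_rfl]
      simp only
      rcases hr with ⟨h1, h2⟩ | ⟨h1, h2⟩ <;> rw [h2]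
      · exact Int.sign_eq_one_of_pos (by omega)
      · exact Int.sign_eq_neg_one_of_neg (by omega)
    rw [closedTurning, hturn, e1, e2, e3] at hmain
    omega

/-- The crossing bound for a chain whose last segment is horizontal and heads west. -/
lemma excess_le_of_west_end (hn : 0 < σ.length) {a : ℤ} (ha : 0 < a)
    (hend : C.pts (σ.length + 1) = (a, 0)) (hx : a < (C.pts σ.length).1)
    (hy : (C.pts σ.length).2 = 0) :
    excess σ ≤ 4 * (crossSet C a).card + 2 * turnSign (σ.getD 0 Turn.L) ∧
    (excess σ = 2 → turnSign (σ.getD 0 Turn.L) = 1 → 2 ≤ (crossSet C a).card) := by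
  have hta := first_segment_lt C hn ha hend
  obtain ⟨s1, s2, s3, s4⟩ := second_segment C hn
  have hone := one_mem_crossSet C hn hta.le
  have hsum := sum_turn_Ico C hn
  have hs := turnSign_cases (σ.getD 0 Turn.L)
  have hcorner : Corner (C.pts (σ.length - 1)) (C.pts σ.length) (a, 0) := by
    have := (corner_and_turn C (show σ.length - 1 < σ.length by omega)).1
    rwa [show σ.length - 1 + 1 = σ.length by omega,
      show σ.length - 1 + 2 = σ.length + 1 by omega, hend] at this
  set n := σ.length with hn_def
  set s := turnSign (σ.getD 0 Turn.L) with hs_def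
  have hn2 : 2 ≤ n := by
    by_contra h
    rw [show n = 1 by omega] at hx
    omega
  set Q := Function.update (stretch C) (n + 2) (a, 2 * s) with hQ_def
  have hQ : ∀ i ≤ n + 1, Q i = ((C.pts i).1, 4 * (C.pts i).2) := fun i hi =>
    Function.update_of_ne (by omega) _ _
  have hQn : Q (n + 1) = (a, 0) := by
    rw [hQ _ le_rfl, hend]
    rfl
  have hQe : Q (n + 2) = (a, 2 * s) := Function.update_self ..
  have hpath : SimplePath Q (n + 2) := by
    constructor
    · intro i hi
      rcases Nat.lt_or_ge i n with h | h
      · rw [hQ i (by omega), hQ (i + 1) (by omega), hQ (i + 2) (by omega)]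
        exact (simplePath_stretch C).corner i (by omega)
      · obtain rfl : i = n := by omega
        rw [hQ n (by omega), hQn, hQe]
        simp only [Corner, Vert, Horiz, true_and]
        omega
    · intro i j hij hj
      rcases Nat.lt_or_ge j (n + 1) with h | h
      · rw [hQ i (by omega), hQ (i + 1) (by omega), hQ j (by omega), hQ (j + 1) (by omega)]
        exact (simplePath_stretch C).sep i j (by omega) (by omega)
      · obtain rfl : j = n + 1 := by omega
        have h1 := endpoint_notMem C (show i < n by omega)
        have h2 := C.axis_parallel i (by omega)
        rw [← hn_def, hend, segSet, Set.mem_ofPred_eq] at h1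
        rw [hQ i (by omega), hQ (i + 1) (by omega), hQn, hQe]
        simp only [Sep] at h1 ⊢
        omega
  have gen : ∀ l ≤ n + 2, (Q l).2 ≠ s := by
    intro l hl
    rcases Nat.lt_or_ge (n + 1) l with h | h
    · obtain rfl : l = n + 2 := by omega
      rw [hQe]
      simp only
      omega
    · rw [hQ l h]
      simp only
      omega
  have hs2 : (0 < (C.pts 2).2 ∧ s = 1) ∨ ((C.pts 2).2 < 0 ∧ s = -1) := by
    rw [← s4]
    exact sign_cases _ fun h => by rw [h, Int.sign_zero] at s4; omega
  have hc1 : Crosses Q s 1 := by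
    rw [Crosses, hQ 1 (by omega), hQ (1 + 1) (by omega)]
    simp only [Nat.reduceAdd]
    omega
  have hce : Crosses Q s (n + 1) := by
    rw [Crosses, hQn, hQe]
    simp only [true_and]
    omega
  have hmem : ∀ k < n + 1, Crosses Q s k → 0 ≤ (Q k).1 → (Q k).1 ≤ a → k ∈ crossSet C a := by
    intro k hk hc h0 h1
    rw [Crosses, hQ k (by omega), hQ (k + 1) (by omega)] at hc
    rw [hQ k (by omega)] at h0 h1
    simp only at hc h0 h1
    rw [mem_crossSet]
    omega
  have hK : ∀ k < n + 2, Crosses Q s k → 0 ≤ (Q k).1 → (Q k).1 ≤ a →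
      k ∈ insert (n + 1) (crossSet C a) := by
    intro k hk hc h0 h1
    rcases Nat.lt_or_ge k (n + 1) with h | h
    · exact Finset.mem_insert_of_mem (hmem k h hc h0 h1)
    · obtain rfl : k = n + 1 := by omega
      exact Finset.mem_insert_self _ _
  have hturn : ∑ l ∈ Finset.Ico 1 (n + 1), turn (Q l) (Q (l + 1)) (Q (l + 2)) =
      excess σ - s - s := by
    rw [Finset.sum_Ico_succ_top (by omega), ← hsum, sub_eq_add_neg _ s]
    congr 1
    · refine Finset.sum_congr rfl fun l hl => ?_
      rw [Finset.mem_Ico] at hl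
      rw [hQ l (by omega), hQ (l + 1) (by omega), hQ (l + 2) (by omega)]
      exact turn_stretch C l (l + 1) (l + 2)
    · rw [hQ n (by omega), hQn, hQe]
      simp only [turn, hy]
      rw [Int.sign_eq_neg_one_of_neg (show a - (C.pts n).1 < 0 by omega)]
      rcases hs with h | h <;> rw [h] <;> simp
  have e1 : ((Q 1).1 - (Q (n + 1)).1).sign = -1 := by
    rw [hQ 1 (by omega), hQn]
    exact Int.sign_eq_neg_one_of_neg (by simp only; omega)
  have e2 : ((Q (1 + 1)).2 - (Q 1).2).sign = s := by
    rw [hQ 1 (by omega), hQ (1 + 1) (by omega)]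
    simp only [sign_four_mul_sub, s1, sub_zero, Nat.reduceAdd, s4]
  have e3 : ((Q (n + 1 + 1)).2 - (Q (n + 1)).2).sign = s := by
    rw [hQn, show n + 1 + 1 = n + 2 from rfl, hQe]
    rcases hs with h | h <;> rw [h] <;> rfl
  have hval : closedTurning Q 1 (n + 1) = excess σ - 2 * s := by
    rw [closedTurning, hturn, e1, e2, e3]
    ring
  constructor
  · have hmain := closedTurning_le hpath gen hK hc1 hce (by omega) le_rfl
      (by rw [hQ 1 (by omega)]; exact s2.le) (by rw [hQ 1 (by omega)]; exact hta.le)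
      (by rw [hQn]; exact ha.le) (by rw [hQn])
    have hind := sum_indicator_le (K := insert (n + 1) (crossSet C a)) (L := crossSet C a)
      (i := 1) (j := n + 1) fun l hl _ hln => Finset.mem_of_mem_insert_of_ne hl (by omega)
    omega
  · intro he hs1
    by_contra hN
    have h1 := abs_closedTurning hpath gen hc1 hce (by omega) le_rfl fun k hk1 hk2 hc hb => by
      rw [hQ 1 (by omega), hQn] at hb
      simp only at hb
      have hk := hmem k hk2 hc (by omega) (by omega)
      exact hN (Finset.one_lt_card.2 ⟨1, hone, k, hk, by omega⟩)
    rw [hval, he, hs1] at h1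
    norm_num at h1

end

end RectChain

/-- **Minimum number of vertical segments crossing the segment from the origin to the
endpoint.** For `l - r ≥ 0`, `l - r ≢ 0 (mod 4)`, and any chain realizing `σ` ending at
`(a, 0)` with `a > 0`: if `σ₁ = L`, at least `|⌊(l-r)/4⌋ - 1| + 1` vertical segments of
the chain meet the closed segment from the origin to the endpoint; if `σ₁ = R`, at
least `⌊(l-r)/4⌋ + 1` of them do. -/
theorem min_vertical_crossings (σ : List Turn) (h0 : 0 ≤ excess σ)
    (h4 : excess σ % 4 ≠ 0) (C : Chain σ) (a : ℤ) (ha : 0 < a)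
    (hend : C.pts (σ.length + 1) = (a, 0)) :
    (σ.head? = some Turn.L →
      |excess σ / 4 - 1| + 1 ≤ (verticalCrossCount σ C a : ℤ)) ∧
    (σ.head? = some Turn.R →
      excess σ / 4 + 1 ≤ (verticalCrossCount σ C a : ℤ)) := by
  open RectChain in
  have hn : 0 < σ.length := by
    rcases σ with _ | ⟨t, σ⟩
    · exact absurd rfl h4
    · exact Nat.succ_pos _
  have hL : σ.head? = some Turn.L → turnSign (σ.getD 0 Turn.L) = 1 := by
    cases σ <;> simp +contextual [turnSign]
  have hR : σ.head? = some Turn.R → turnSign (σ.getD 0 Turn.L) = -1 := by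
    cases σ <;> simp +contextual [turnSign]
  have hcount : verticalCrossCount σ C a = (crossSet C a).card := rfl
  have habs : |excess σ / 4 - 1| ≤ max (excess σ / 4 - 1) (1 - excess σ / 4) :=
    abs_le.2 (by omega)
  have haxis := C.axis_parallel σ.length le_rfl
  rw [hend] at haxis
  simp only at haxis
  rw [hcount]
  rcases haxis with ⟨hx, hy⟩ | ⟨hy, hx⟩
  · obtain ⟨h2, r, hr, hle⟩ := excess_le_of_vertical_end C hn ha hend hx.symm hy.symm
    refine ⟨fun h => ?_, fun h => ?_⟩
    · rw [hL h] at hle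
      omega
    · rw [hR h] at hle
      omega
  · have hdir := excess_emod C
    rw [hend, dirIndex] at hdir
    simp only at hdir
    have hxa : a < (C.pts σ.length).1 ∧ excess σ % 4 = 2 := by
      split_ifs at hdir <;> omega
    obtain ⟨hle, h2⟩ := excess_le_of_west_end C hn ha hend hxa.1 hy.symm
    refine ⟨fun h => ?_, fun h => ?_⟩
    · have h2' := fun he => h2 he (hL h)
      rw [hL h] at hle
      omega
    · rw [hR h] at hle
      omega
end
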